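/- arXiv:1905.04244 — 3 statements merged into one kernel-verified Lean document; each statement's English description precedes it below -/
import Mathlib

section
/- Let p be a prime, q a power of p with q > 2, and n a positive integer. Then for T = T(n,q): |T^p| = Σ_{(a_1,…,a_k) ⊢ n, k < q} ( (q−1)(q−2)⋯(q−k) · n! / ∏_{b=1}^{n} ( m_b! · (b!)^{m_b} ) ) · ( ∏_{i=1}^{k} |U(a_i,q)^p| ) · q^{ C(n,2) − Σ_{i=1}^{k} C(a_i,2) }, where the sum runs over all partitions (a_1,…,a_k) of n of length k < q, the m_b are defined by writing the partition in power notation 1^{m_1} 2^{m_2} ⋯ n^{m_n} (m_b is the number of parts equal to b), and C(n,2) = n(n−1)/2 denotes the binomial coefficient. -/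
/-- A matrix is lower unitriangular: all diagonal entries are `1` and all entries
above the diagonal are `0`. -/
def IsUnitriangular {n : ℕ} {F : Type*} [Field F] (A : Matrix (Fin n) (Fin n) F) : Prop :=
  (∀ i, A i i = 1) ∧ ∀ i j : Fin n, i < j → A i j = 0

/-- A matrix is invertible lower triangular: all entries above the diagonal are `0`
and all diagonal entries are nonzero. -/
def IsTriangular {n : ℕ} {F : Type*} [Field F] (A : Matrix (Fin n) (Fin n) F) : Prop :=
  (∀ i j : Fin n, i < j → A i j = 0) ∧ ∀ i, A i i ≠ 0

theorem card_functions_with_fiber_cards_mul {α β : Type*} [Fintype α] [Fintype β]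
    (m : β → ℕ) (hm : ∑ b, m b = Fintype.card α) :
    Nat.card {f : α → β // ∀ b, Nat.card {a // f a = b} = m b} * ∏ b, (m b).factorial
      = (Fintype.card α).factorial := by
  classical
  have hcard : Fintype.card α = Fintype.card (Σ b, Fin (m b)) := by simp [hm]
  let g : α ≃ Σ b, Fin (m b) := Fintype.equivOfCardEq hcard
  let f₀ : α → β := fun a => (g a).1
  have hf₀ : ∀ b, Nat.card {a // f₀ a = b} = m b := by
    intro b
    rw [Nat.card_congr ((g.subtypeEquiv (q := fun x => x.1 = b) fun a => Iff.rfl).trans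
      (Equiv.sigmaSubtype b))]
    simp
  have horb : ∀ f : α → β, (∀ b, Nat.card {a // f a = b} = m b) ↔
      f ∈ MulAction.orbit (Equiv.Perm α)ᵈᵐᵃ f₀ := by
    intro f
    constructor
    · intro hf
      let e : ∀ b, {a // f a = b} ≃ {a // f₀ a = b} := fun b =>
        (Finite.card_eq.1 ((hf b).trans (hf₀ b).symm)).some
      let σ : Equiv.Perm α := (Equiv.sigmaFiberEquiv f).symm.trans
        ((Equiv.sigmaCongrRight e).trans (Equiv.sigmaFiberEquiv f₀))
      refine ⟨DomMulAct.mk σ, ?_⟩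
      funext a
      exact (e (f a) ⟨a, rfl⟩).2
    · rintro ⟨σ, rfl⟩ b
      rw [← hf₀ b]
      exact Nat.card_congr ((DomMulAct.mk.symm σ).subtypeEquiv fun a => Iff.rfl)
  have h1 := Nat.card_congr (MulAction.orbitProdStabilizerEquivGroup (Equiv.Perm α)ᵈᵐᵃ f₀)
  rw [Nat.card_prod] at h1
  have h2 : Nat.card (MulAction.stabilizer (Equiv.Perm α)ᵈᵐᵃ f₀) = ∏ b, (m b).factorial := by
    rw [← Nat.card_congr MulOpposite.opEquiv.symm,
      Nat.card_congr (DomMulAct.stabilizerMulEquiv f₀).toEquiv, Nat.card_pi]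
    refine Finset.prod_congr rfl fun b _ => ?_
    rw [Nat.card_perm, hf₀]
  rw [Nat.card_congr (Equiv.subtypeEquivRight horb), ← h2]
  refine h1.trans ?_
  rw [← Nat.card_congr DomMulAct.mk, Nat.card_perm, Nat.card_eq_fintype_card]

/-- The multiset of nonzero values of a natural-valued function on a finite type. -/
def nonzeroValues {κ : Type*} [Fintype κ] (a : κ → ℕ) : Multiset ℕ :=
  (Finset.univ.val.map a).filter (· ≠ 0)

theorem prod_map_nonzeroValues {κ M : Type*} [Fintype κ] [CommMonoid M] (a : κ → ℕ)
    (f : ℕ → M) (hf : f 0 = 1) : ((nonzeroValues a).map f).prod = ∏ c, f (a c) := by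
  have h : ∀ s : Multiset ℕ, ((s.filter (· ≠ 0)).map f).prod = (s.map f).prod := by
    intro s
    induction s using Multiset.induction with
    | empty => simp
    | cons x s ih =>
      by_cases hx : x = 0
      · simp [hx, hf, ← ih]
      · simp [hx, ← ih]
  rw [nonzeroValues, h, Multiset.map_map]
  rfl

theorem sum_nonzeroValues {κ : Type*} [Fintype κ] (a : κ → ℕ) :
    (nonzeroValues a).sum = ∑ c, a c := by
  have := prod_map_nonzeroValues a (fun x => Multiplicative.ofAdd x) rfl
  have h := congrArg Multiplicative.toAdd this
  rw [toAdd_prod] at h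
  simpa [toAdd_multiset_sum] using h

theorem nonzeroValues_eq_iff {κ : Type*} [Fintype κ] {n : ℕ} (δ : n.Partition)
    (a : κ → Fin (n + 1)) :
    nonzeroValues (fun c => (a c : ℕ)) = δ.parts ↔
      ∀ b : Fin (n + 1), Nat.card {c // a c = b} =
        if b = 0 then Fintype.card κ - δ.parts.card else δ.parts.count (b : ℕ) := by
  classical
  have hcount : ∀ b : Fin (n + 1), Nat.card {c // a c = b} =
      (Finset.univ.val.map fun c => (a c : ℕ)).count (b : ℕ) := by
    intro b
    rw [Multiset.count_map, Nat.card_eq_fintype_card, Fintype.card_subtype]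
    change _ = (Finset.univ.filter fun c => (b : ℕ) = a c).card
    congr 1
    ext c
    simp [Fin.ext_iff, eq_comm]
  constructor
  · intro h b
    split_ifs with hb
    · subst hb
      rw [hcount, ← h, nonzeroValues, Fin.val_zero]
      have h1 := congrArg Multiset.card
        (Multiset.filter_add_not (· = 0) (Finset.univ.val.map fun c => (a c : ℕ)))
      simp only [Multiset.card_add, Multiset.card_map, Finset.card_val,
        Finset.card_univ] at h1
      have h2 : ∀ s : Multiset ℕ, s.count 0 = (s.filter (· = 0)).card := fun s => by
        rw [Multiset.count_eq_card_filter_eq]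
        exact congrArg _ (Multiset.filter_congr fun x _ => eq_comm)
      rw [h2]
      exact Nat.eq_sub_of_add_eq h1
    · rw [hcount, ← h, nonzeroValues, Multiset.count_filter_of_pos]
      exact fun h => hb (Fin.ext h)
  · intro h
    ext b
    rcases Nat.eq_zero_or_pos b with rfl | hb
    · rw [Multiset.count_eq_zero_of_notMem, Multiset.count_eq_zero_of_notMem]
      · intro h0; exact absurd (δ.parts_pos h0) (by simp)
      · simp [nonzeroValues]
    · by_cases hbn : b < n + 1
      · have := h ⟨b, hbn⟩
        rw [hcount, if_neg (by simp [Fin.ext_iff]; omega)] at this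
        rw [nonzeroValues, Multiset.count_filter_of_pos (by omega)]
        exact this
      · rw [Multiset.count_eq_zero_of_notMem, Multiset.count_eq_zero_of_notMem]
        · intro h0
          have := Multiset.single_le_sum (by simp) b h0
          rw [δ.parts_sum] at this
          omega
        · simp only [nonzeroValues, Multiset.mem_filter, Multiset.mem_map]
          rintro ⟨⟨c, -, rfl⟩, -⟩
          exact hbn (a c).2

theorem Nat.Partition.parts_toFinset_subset_Icc {n : ℕ} (δ : n.Partition) :
    δ.parts.toFinset ⊆ Finset.Icc 1 n := by
  intro b hb
  rw [Multiset.mem_toFinset] at hb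
  have := Multiset.single_le_sum (by simp) b hb
  rw [δ.parts_sum] at this
  exact Finset.mem_Icc.2 ⟨δ.parts_pos hb, this⟩

theorem prod_fin_succ_eq_prod_Icc {M : Type*} [CommMonoid M] (n : ℕ) (f : ℕ → M) :
    ∏ i : Fin n, f (i + 1) = ∏ b ∈ Finset.Icc 1 n, f b := by
  rw [Fin.prod_univ_eq_prod_range (fun i => f (i + 1)), Finset.range_eq_Ico,
    Finset.prod_Ico_add' f 0 n 1]
  rfl

theorem card_nonzeroValues_eq_mul {κ : Type*} [Fintype κ] {n : ℕ} (δ : n.Partition)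
    (hδ : δ.parts.card ≤ Fintype.card κ) :
    Nat.card {a : κ → Fin (n + 1) // nonzeroValues (fun c => (a c : ℕ)) = δ.parts} *
      ∏ b ∈ Finset.Icc 1 n, (δ.parts.count b).factorial
      = (Fintype.card κ).descFactorial δ.parts.card := by
  have hsum : ∑ b ∈ Finset.Icc 1 n, δ.parts.count b = δ.parts.card :=
    Multiset.sum_count_eq_card fun b hb =>
      δ.parts_toFinset_subset_Icc (Multiset.mem_toFinset.2 hb)
  have key := card_functions_with_fiber_cards_mul (α := κ) (β := Fin (n + 1))
    (fun b => if b = 0 then Fintype.card κ - δ.parts.card else δ.parts.count (b : ℕ)) (by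
      rw [Fin.sum_univ_succ]
      have := prod_fin_succ_eq_prod_Icc n fun b => Multiplicative.ofAdd (δ.parts.count b)
      have h2 : ∑ i : Fin n, δ.parts.count ((i : ℕ) + 1) =
        ∑ b ∈ Finset.Icc 1 n, δ.parts.count b := by
        simpa [← ofAdd_sum] using this
      simp [Fin.succ_ne_zero, h2, hsum]
      omega)
  rw [Fin.prod_univ_succ] at key
  have h3 := prod_fin_succ_eq_prod_Icc n fun b => (δ.parts.count b).factorial
  simp only [Fin.succ_ne_zero, if_false, if_true, Fin.val_succ, h3] at key
  rw [Nat.card_congr (Equiv.subtypeEquivRight fun a => nonzeroValues_eq_iff δ a)]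
  refine Nat.eq_of_mul_eq_mul_left (Nat.factorial_pos (Fintype.card κ - δ.parts.card)) ?_
  rw [Nat.factorial_mul_descFactorial hδ, ← key]
  ring

theorem card_fiber_type_eq_mul {κ : Type*} [Fintype κ] {n : ℕ} (δ : n.Partition)
    (hδ : δ.parts.card ≤ Fintype.card κ) :
    Nat.card {d : Fin n → κ // nonzeroValues (fun c => Nat.card {i // d i = c}) = δ.parts} *
      ∏ b ∈ Finset.Icc 1 n, ((δ.parts.count b).factorial * b.factorial ^ δ.parts.count b)
      = (Fintype.card κ).descFactorial δ.parts.card * n.factorial := by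
  classical
  have hle : ∀ (d : Fin n → κ) c, Nat.card {i // d i = c} < n + 1 := fun d c => by
    have := Finite.card_subtype_le (fun i => d i = c)
    simp at this ⊢
    omega
  let S := {a : κ → Fin (n + 1) // nonzeroValues (fun c => (a c : ℕ)) = δ.parts}
  let e : {d : Fin n → κ // nonzeroValues (fun c => Nat.card {i // d i = c}) = δ.parts} ≃
      Σ a : S, {d : Fin n → κ // ∀ c, Nat.card {i // d i = c} = (a.1 c : ℕ)} :=
    { toFun := fun d => ⟨⟨fun c => ⟨Nat.card {i // d.1 i = c}, hle d.1 c⟩, d.2⟩, d.1, fun c => rfl⟩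
      invFun := fun x => ⟨x.2.1, by
        exact (congrArg nonzeroValues (funext x.2.2)).trans x.1.2⟩
      left_inv := fun d => rfl
      right_inv := by
        rintro ⟨⟨a, ha⟩, d, hd⟩
        have : a = fun c => ⟨Nat.card {i // d i = c}, hle d c⟩ := by
          funext c; exact Fin.ext (hd c).symm
        subst this
        rfl }
  have hfib : ∀ a : S, Nat.card {d : Fin n → κ // ∀ c, Nat.card {i // d i = c} = (a.1 c : ℕ)} *
      ∏ b ∈ Finset.Icc 1 n, b.factorial ^ δ.parts.count b = n.factorial := by
    intro a
    have h1 := card_functions_with_fiber_cards_mul (α := Fin n) (fun c => (a.1 c : ℕ)) (by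
      rw [← sum_nonzeroValues, a.2, δ.parts_sum, Fintype.card_fin])
    rw [← prod_map_nonzeroValues (fun c => (a.1 c : ℕ)) Nat.factorial rfl, a.2,
      Finset.prod_multiset_map_count, Fintype.card_fin] at h1
    rw [← h1]
    congr 1
    refine (Finset.prod_subset δ.parts_toFinset_subset_Icc fun b _ hb => ?_).symm
    rw [Multiset.count_eq_zero_of_notMem (by simpa using hb), pow_zero]
  rw [Nat.card_congr e, Nat.card_sigma, Finset.prod_mul_distrib, mul_left_comm, Finset.sum_mul,
    Finset.sum_congr rfl fun a _ => hfib a, ← card_nonzeroValues_eq_mul δ hδ]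
  simp [S]
  ring

/-- If a subset `P` of a `G`-set is stable under `C ≤ U` and every element of `U` carrying a point
of `P` into `P` lies in `C`, then the saturation `U • P` is `U ×_C P`. -/
theorem ncard_smul_mul_card {G X : Type*} [Group G] [MulAction G X]
    (U C : Subgroup G) (hCU : C ≤ U) (P : Set X) (hP : ∀ c ∈ C, ∀ x ∈ P, c • x ∈ P)
    (h : ∀ u ∈ U, ∀ x ∈ P, u • x ∈ P → u ∈ C) :
    Set.ncard {y : X | ∃ u ∈ U, ∃ x ∈ P, u • x = y} * Nat.card C = Nat.card U * P.ncard := by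
  rw [← Nat.card_coe_set_eq, ← Nat.card_coe_set_eq, ← Nat.card_prod, ← Nat.card_prod]
  choose u hu x hx hux using fun y : {y : X | ∃ u ∈ U, ∃ x ∈ P, u • x = y} => y.2
  refine Nat.card_eq_of_bijective (fun z => (⟨u z.1 * z.2, U.mul_mem (hu _) (hCU z.2.2)⟩,
    ⟨(z.2 : G)⁻¹ • x z.1, hP _ (C.inv_mem z.2.2) _ (hx _)⟩)) ⟨?_, ?_⟩
  · rintro ⟨y, c⟩ ⟨y', c'⟩ hy
    simp only [Prod.mk.injEq, Subtype.mk.injEq] at hy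
    obtain rfl : y = y' := by
      refine Subtype.ext ?_
      rw [← hux y, ← hux y']
      have : (u y * c) • ((c : G)⁻¹ • x y) = (u y' * c') • ((c' : G)⁻¹ • x y') := by
        rw [hy.1, hy.2]
      simpa [mul_smul] using this
    have hc := mul_left_cancel hy.1
    rw [Subtype.ext hc]
  · rintro ⟨⟨v, hv⟩, ⟨w, hw⟩⟩
    let y : {y : X | ∃ u ∈ U, ∃ x ∈ P, u • x = y} := ⟨v • w, v, hv, w, hw, rfl⟩
    have hy : u y • x y = v • w := hux y
    have hy2 : ((u y)⁻¹ * v) • w = x y := by rw [mul_smul, ← hy, inv_smul_smul]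
    have hc : (u y)⁻¹ * v ∈ C :=
      h _ (U.mul_mem (U.inv_mem (hu _)) hv) w hw (hy2 ▸ hx y)
    refine ⟨⟨y, ⟨_, hc⟩⟩, ?_⟩
    simp only [Prod.mk.injEq, Subtype.mk.injEq]
    refine ⟨by simp, ?_⟩
    rw [← hy2, inv_smul_smul]

section TriangularSets

variable {ι κ F : Type*} [Fintype ι] [LinearOrder ι] [Field F]

/-- The lower triangular matrices with diagonal `e`. -/
def triSet (e : ι → F) : Set (Matrix ι ι F) :=
  {A | (∀ i j, i < j → A i j = 0) ∧ ∀ i, A i i = e i}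

/-- The lower triangular matrices with diagonal `e` that are block diagonal with respect to the
fibers of `d`. -/
def blockSet (d : ι → κ) (e : ι → F) : Set (Matrix ι ι F) :=
  {A | A ∈ triSet e ∧ ∀ i j, d i ≠ d j → A i j = 0}

omit [Fintype ι] in
theorem blockSet_const (e : ι → F) : blockSet (fun _ : ι => ()) e = triSet e := by
  ext A; simp [blockSet]

theorem mul_mem_triSet {e e' : ι → F} {A B : Matrix ι ι F} (hA : A ∈ triSet e)
    (hB : B ∈ triSet e') : A * B ∈ triSet (e * e') := by
  constructor
  · intro i j hij
    rw [Matrix.mul_apply]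
    refine Finset.sum_eq_zero fun k _ => ?_
    rcases lt_or_ge i k with h | h
    · rw [hA.1 _ _ h, zero_mul]
    · rw [hB.1 _ _ (h.trans_lt hij), mul_zero]
  · intro i
    rw [Matrix.mul_apply, Finset.sum_eq_single i, hA.2, hB.2, Pi.mul_apply]
    · intro k _ hk
      rcases lt_or_gt_of_ne hk with h | h
      · rw [hB.1 _ _ h, mul_zero]
      · rw [hA.1 _ _ h, zero_mul]
    · simp

theorem mul_mem_blockSet {d : ι → κ} {e e' : ι → F} {A B : Matrix ι ι F}
    (hA : A ∈ blockSet d e) (hB : B ∈ blockSet d e') : A * B ∈ blockSet d (e * e') := by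
  refine ⟨mul_mem_triSet hA.1 hB.1, fun i j hij => ?_⟩
  rw [Matrix.mul_apply]
  refine Finset.sum_eq_zero fun k _ => ?_
  by_cases h : d i = d k
  · rw [hB.2 _ _ (h ▸ hij), mul_zero]
  · rw [hA.2 _ _ h, zero_mul]

omit [Fintype ι] in
theorem one_mem_blockSet (d : ι → κ) : (1 : Matrix ι ι F) ∈ blockSet d 1 :=
  ⟨⟨fun _ _ h => Matrix.one_apply_ne h.ne, fun _ => Matrix.one_apply_eq _⟩,
    fun _ _ h => Matrix.one_apply_ne fun h' => h (congrArg d h')⟩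

theorem pow_mem_blockSet {d : ι → κ} {e : ι → F} {A : Matrix ι ι F}
    (hA : A ∈ blockSet d e) (m : ℕ) : A ^ m ∈ blockSet d (e ^ m) := by
  induction m with
  | zero => simpa using one_mem_blockSet d
  | succ m ih => rw [pow_succ, pow_succ]; exact mul_mem_blockSet ih hA

theorem pow_mem_triSet {e : ι → F} {A : Matrix ι ι F}
    (hA : A ∈ triSet e) (m : ℕ) : A ^ m ∈ triSet (e ^ m) := by
  rw [← blockSet_const] at *
  exact pow_mem_blockSet hA m

theorem isUnit_of_mem_triSet_one {A : Matrix ι ι F} (hA : A ∈ triSet (1 : ι → F)) :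
    IsUnit A := by
  rw [Matrix.isUnit_iff_isUnit_det, Matrix.det_of_isLowerTriangular A (fun i j h => hA.1 i j h)]
  simp [hA.2]

/-- A matrix intertwining two block matrices whose distinct blocks have distinct diagonal entries
is itself a block matrix. -/
theorem mem_blockSet_of_mul_eq_mul {d : ι → κ} {e f : ι → F}
    (he : ∀ i j, d i ≠ d j → e i ≠ e j) {u M N : Matrix ι ι F} (hu : u ∈ triSet f)
    (hM : M ∈ blockSet d e) (hN : N ∈ blockSet d e) (h : u * M = N * u) : u ∈ blockSet d f := by
  classical
  refine ⟨hu, ?_⟩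
  suffices H : ∀ (m : ℕ) (i j : ι), (Finset.univ.filter fun k => j < k ∧ k < i).card = m →
      d i ≠ d j → u i j = 0 from fun i j => H _ i j rfl
  intro m
  induction m using Nat.strong_induction_on with
  | _ m ih =>
  rintro i j rfl hij
  have h1 : (u * M) i j = u i j * e j := by
    rw [Matrix.mul_apply, Finset.sum_eq_single j, hM.1.2]
    · intro k _ hk
      by_cases hd : d k = d j
      · rcases lt_or_gt_of_ne hk with hkj | hjk
        · rw [hM.1.1 _ _ hkj, mul_zero]
        · rcases lt_trichotomy i k with hik | rfl | hki
          · rw [hu.1 _ _ hik, zero_mul]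
          · exact absurd hd hij
          · rw [ih _ (Finset.card_lt_card ?_) i k rfl (hd ▸ hij), zero_mul]
            refine Finset.ssubset_iff_of_subset (fun l hl => ?_) |>.2 ⟨k, by simp [hjk, hki], by simp⟩
            simp only [Finset.mem_filter, Finset.mem_univ, true_and] at hl ⊢
            exact ⟨hjk.trans hl.1, hl.2⟩
      · rw [hM.2 _ _ hd, mul_zero]
    · simp
  have h2 : (N * u) i j = e i * u i j := by
    rw [Matrix.mul_apply, Finset.sum_eq_single i, hN.1.2]
    · intro k _ hk
      by_cases hd : d i = d k
      · rcases lt_or_gt_of_ne hk with hki | hik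
        · rcases lt_trichotomy k j with hkj | rfl | hjk
          · rw [hu.1 _ _ hkj, mul_zero]
          · exact absurd hd hij
          · rw [ih _ (Finset.card_lt_card ?_) k j rfl (hd ▸ hij), mul_zero]
            refine Finset.ssubset_iff_of_subset (fun l hl => ?_) |>.2 ⟨k, by simp [hjk, hki], by simp⟩
            simp only [Finset.mem_filter, Finset.mem_univ, true_and] at hl ⊢
            exact ⟨hl.1, hl.2.trans hki⟩
        · rw [hN.1.1 _ _ hik, zero_mul]
      · rw [hN.2 _ _ hd, zero_mul]
    · simp
  rw [h, h2] at h1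
  have h3 : (e i - e j) * u i j = 0 := by linear_combination h1
  exact (mul_eq_zero.1 h3).resolve_left (sub_ne_zero.2 (he i j hij))

/-- The unipotent block matrices, acting on all matrices by conjugation. -/
def blockGroup [Finite F] (d : ι → κ) : Subgroup (ConjAct (Matrix ι ι F)ˣ) where
  carrier := {g | ((ConjAct.ofConjAct g : (Matrix ι ι F)ˣ) : Matrix ι ι F) ∈ blockSet d 1}
  one_mem' := one_mem_blockSet d
  mul_mem' {a b} ha hb := by
    have := mul_mem_blockSet ha hb
    rwa [mul_one] at this
  inv_mem' {a} ha := by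
    have : Finite (ConjAct (Matrix ι ι F)ˣ) := inferInstanceAs (Finite (Matrix ι ι F)ˣ)
    obtain ⟨m, hm⟩ := mem_powers_iff_mem_zpowers.2
      (Subgroup.inv_mem _ (Subgroup.mem_zpowers a))
    change a ^ m = a⁻¹ at hm
    have := pow_mem_blockSet (Set.mem_ofPred_eq ▸ ha) m
    rw [one_pow] at this
    rw [← hm]
    exact this

theorem card_blockGroup [Finite F] (d : ι → κ) :
    Nat.card (blockGroup (F := F) d) = (blockSet d (1 : ι → F)).ncard := by
  rw [← Nat.card_coe_set_eq]
  refine Nat.card_eq_of_bijective (fun g => ⟨_, g.2⟩) ⟨fun a b hab => ?_, fun A => ?_⟩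
  · exact Subtype.ext (Units.ext (congrArg Subtype.val hab))
  · obtain ⟨u, hu⟩ := isUnit_of_mem_triSet_one A.2.1
    exact ⟨⟨ConjAct.toConjAct u, by
      change (u : Matrix ι ι F) ∈ blockSet d 1; rw [hu]; exact A.2⟩, Subtype.ext hu⟩

theorem blockGroup_smul_mem [Finite F] {d : ι → κ} {e : ι → F} {u : ConjAct (Matrix ι ι F)ˣ}
    (hu : u ∈ blockGroup d) {N : Matrix ι ι F} (hN : N ∈ blockSet d e) :
    u • N ∈ blockSet d e := by
  rw [ConjAct.units_smul_def]
  have := mul_mem_blockSet (mul_mem_blockSet hu hN) ((blockGroup d).inv_mem hu)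
  rwa [mul_one, one_mul] at this

theorem ncard_conj_mul_card [Finite F] {d : ι → κ} {e : ι → F}
    (he : ∀ i j, d i ≠ d j → e i ≠ e j) {P : Set (Matrix ι ι F)} (hPe : P ⊆ blockSet d e)
    (hP : ∀ c ∈ blockGroup (F := F) d, ∀ x ∈ P, c • x ∈ P) :
    Set.ncard {y | ∃ u ∈ blockGroup (F := F) fun _ : ι => (), ∃ x ∈ P, u • x = y} *
      (blockSet d (1 : ι → F)).ncard = (triSet (1 : ι → F)).ncard * P.ncard := by
  rw [← card_blockGroup, ← blockSet_const, ← card_blockGroup]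
  refine ncard_smul_mul_card _ _ (fun u hu => ?_) P hP fun u hu x hx hux => ?_
  · change _ ∈ blockSet _ _
    rw [blockSet_const]
    exact hu.1
  · change _ ∈ blockSet _ _ at hu
    rw [blockSet_const] at hu
    refine mem_blockSet_of_mul_eq_mul he hu (hPe hx) (hPe hux) ?_
    rw [ConjAct.units_smul_def, mul_assoc, Units.inv_mul, mul_one]

/-- The diagonal block of a matrix on the fiber of `d` over `c`. -/
def fiberBlock (d : ι → κ) (c : κ) (A : Matrix ι ι F) :
    Matrix {i // d i = c} {i // d i = c} F :=
  A.submatrix Subtype.val Subtype.val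

open Classical in
/-- The block diagonal matrix with given diagonal blocks on the fibers of `d`. -/
noncomputable def glueBlocks (d : ι → κ) (N : ∀ c, Matrix {i // d i = c} {i // d i = c} F) :
    Matrix ι ι F :=
  fun i j => if h : d i = d j then N (d j) ⟨i, h⟩ ⟨j, rfl⟩ else 0

omit [Fintype ι] [LinearOrder ι] in
theorem fiberBlock_glueBlocks (d : ι → κ)
    (N : ∀ c, Matrix {i // d i = c} {i // d i = c} F) (c : κ) :
    fiberBlock d c (glueBlocks d N) = N c := by
  ext ⟨i, hi⟩ ⟨j, hj⟩
  subst hj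
  simp [fiberBlock, glueBlocks, hi]

omit [Fintype ι] [LinearOrder ι] in
theorem glueBlocks_apply_ne (d : ι → κ)
    (N : ∀ c, Matrix {i // d i = c} {i // d i = c} F) (i j : ι) (h : d i ≠ d j) :
    glueBlocks d N i j = 0 := by
  simp [glueBlocks, h]

omit [Fintype ι] [LinearOrder ι] in
theorem ext_fiberBlock {d : ι → κ} {A B : Matrix ι ι F} (hA : ∀ i j, d i ≠ d j → A i j = 0)
    (hB : ∀ i j, d i ≠ d j → B i j = 0) (h : ∀ c, fiberBlock d c A = fiberBlock d c B) :
    A = B := by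
  ext i j
  by_cases hij : d i = d j
  · exact congrFun (congrFun (h (d j)) ⟨i, hij⟩) ⟨j, rfl⟩
  · rw [hA _ _ hij, hB _ _ hij]

omit [Fintype ι] [LinearOrder ι] in
theorem ncard_eq_prod_of_fiberBlock [Finite ι] [Fintype κ] (d : ι → κ) (P : Set (Matrix ι ι F))
    (Q : ∀ c, Set (Matrix {i // d i = c} {i // d i = c} F))
    (h : ∀ A, A ∈ P ↔ (∀ i j, d i ≠ d j → A i j = 0) ∧ ∀ c, fiberBlock d c A ∈ Q c) :
    P.ncard = ∏ c, (Q c).ncard := by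
  simp_rw [← Nat.card_coe_set_eq]
  rw [← Nat.card_pi]
  refine Nat.card_eq_of_bijective (fun A c => ⟨fiberBlock d c A, ((h A).1 A.2).2 c⟩) ⟨?_, ?_⟩
  · intro A B hAB
    exact Subtype.ext (ext_fiberBlock ((h A).1 A.2).1 ((h B).1 B.2).1
      fun c => congrArg Subtype.val (congrFun hAB c))
  · intro N
    refine ⟨⟨glueBlocks d fun c => (N c).1, (h _).2 ⟨glueBlocks_apply_ne d _, fun c => ?_⟩⟩, ?_⟩
    · rw [fiberBlock_glueBlocks]; exact (N c).2
    · funext c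
      exact Subtype.ext (fiberBlock_glueBlocks d (fun c => (N c).1) c)

omit [Fintype ι] in
theorem mem_blockSet_iff_fiberBlock (d : ι → κ) (e : ι → F) (A : Matrix ι ι F) :
    A ∈ blockSet d e ↔ (∀ i j, d i ≠ d j → A i j = 0) ∧
      ∀ c, fiberBlock d c A ∈ triSet fun i : {i // d i = c} => e i := by
  constructor
  · exact fun hA => ⟨hA.2, fun c => ⟨fun i j hij => hA.1.1 _ _ hij, fun i => hA.1.2 _⟩⟩
  · refine fun hA => ⟨⟨fun i j hij => ?_, fun i => (hA.2 (d i)).2 ⟨i, rfl⟩⟩, hA.1⟩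
    by_cases h : d i = d j
    · exact (hA.2 (d j)).1 ⟨i, h⟩ ⟨j, rfl⟩ hij
    · exact hA.1 _ _ h

omit [LinearOrder ι] in
theorem fiberBlock_mul (d : ι → κ) (c : κ) [Fintype {i // d i = c}] {A : Matrix ι ι F}
    (hA : ∀ i j, d i ≠ d j → A i j = 0) (B : Matrix ι ι F) :
    fiberBlock d c (A * B) = fiberBlock d c A * fiberBlock d c B := by
  classical
  ext i j
  simp only [fiberBlock, Matrix.submatrix_apply, Matrix.mul_apply]
  rw [← Finset.sum_filter_add_sum_filter_not Finset.univ (fun k => d k = c),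
    Finset.sum_eq_zero (s := Finset.univ.filter fun k => ¬ d k = c), add_zero,
    Finset.sum_subtype _ (p := fun k => d k = c) (by simp)]
  intro k hk
  rw [hA, zero_mul]
  rw [i.2]
  simpa [eq_comm] using hk

theorem fiberBlock_pow (d : ι → κ) (c : κ) [Fintype {i // d i = c}] {e : ι → F}
    {A : Matrix ι ι F} (hA : A ∈ blockSet d e) (m : ℕ) :
    fiberBlock d c (A ^ m) = fiberBlock d c A ^ m := by
  induction m with
  | zero => ext i j; simp [fiberBlock, Matrix.one_apply, Subtype.ext_iff]
  | succ m ih => rw [pow_succ, fiberBlock_mul d c (pow_mem_blockSet hA m).2, ih, pow_succ]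

theorem ncard_blockSet [DecidableEq κ] [Fintype κ] (d : ι → κ) (e : ι → F) :
    (blockSet d e).ncard = ∏ c, (triSet fun i : {i // d i = c} => e i).ncard :=
  ncard_eq_prod_of_fiberBlock d _ _ (mem_blockSet_iff_fiberBlock d e)

theorem ncard_blockSet_pow [DecidableEq κ] [Fintype κ] (d : ι → κ) (e : ι → F) (m : ℕ) :
    {B | ∃ A ∈ blockSet d e, A ^ m = B}.ncard =
      ∏ c, {B | ∃ A ∈ triSet fun i : {i // d i = c} => e i, A ^ m = B}.ncard := by
  refine ncard_eq_prod_of_fiberBlock d _ _ fun B => ⟨?_, ?_⟩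
  · rintro ⟨A, hA, rfl⟩
    exact ⟨(pow_mem_blockSet hA m).2, fun c =>
      ⟨_, ((mem_blockSet_iff_fiberBlock d e A).1 hA).2 c, (fiberBlock_pow d c hA m).symm⟩⟩
  · rintro ⟨hB, h⟩
    choose N hN hNB using h
    have hA : glueBlocks d N ∈ blockSet d e :=
      (mem_blockSet_iff_fiberBlock d e _).2 ⟨glueBlocks_apply_ne d N, fun c => by
        rw [fiberBlock_glueBlocks]; exact hN c⟩
    refine ⟨_, hA, ext_fiberBlock (pow_mem_blockSet hA m).2 hB fun c => ?_⟩
    rw [fiberBlock_pow d c hA, fiberBlock_glueBlocks, hNB]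

theorem ncard_triSet [Finite F] (e : ι → F) :
    (triSet e).ncard = Nat.card F ^ (Fintype.card ι).choose 2 := by
  classical
  have hcard : Nat.card {x : ι × ι // x.2 < x.1} = (Fintype.card ι).choose 2 := by
    have h1 : Nat.card {x : ι × ι // x.2 < x.1} = Nat.card {x : ι × ι // x.1 < x.2} :=
      Nat.card_congr ((Equiv.prodComm ι ι).subtypeEquiv fun _ => Iff.rfl)
    have h2 : (Finset.univ : Finset ι).offDiag.card =
        Nat.card {x : ι × ι // x.2 < x.1} + Nat.card {x : ι × ι // x.1 < x.2} := by
      rw [Nat.card_eq_fintype_card, Nat.card_eq_fintype_card, Fintype.card_subtype,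
        Fintype.card_subtype, ← Finset.card_union_of_disjoint]
      · congr 1
        ext ⟨i, j⟩
        simp [lt_or_lt_iff_ne, ne_comm]
      · rw [Finset.disjoint_left]
        intro x hx hx'
        simp only [Finset.mem_filter] at hx hx'
        exact lt_asymm hx.2 hx'.2
    rw [Finset.offDiag_card, Finset.card_univ, ← h1, ← Nat.mul_sub_one] at h2
    rw [Nat.choose_two_right]
    omega
  rw [← Nat.card_coe_set_eq, ← hcard, ← Nat.card_fun]
  refine Nat.card_eq_of_bijective (fun A x => A.1 x.1.1 x.1.2) ⟨fun A B hAB => ?_, fun g => ?_⟩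
  · refine Subtype.ext (Matrix.ext fun i j => ?_)
    rcases lt_trichotomy i j with h | rfl | h
    · rw [A.2.1 _ _ h, B.2.1 _ _ h]
    · rw [A.2.2, B.2.2]
    · exact congrFun hAB ⟨(i, j), h⟩
  · refine ⟨⟨Matrix.of fun i j => if h : j < i then g ⟨(i, j), h⟩ else if i = j then e i else 0,
      fun i j hij => ?_, fun i => ?_⟩, ?_⟩
    · simp [hij.not_gt, hij.ne]
    · simp
    · funext ⟨⟨i, j⟩, h⟩
      simp [show j < i from h]

theorem ncard_triSet_const_pow {x : F} (hx : x ≠ 0) (m : ℕ) :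
    {B | ∃ A ∈ triSet fun _ : ι => x, A ^ m = B}.ncard =
      {B | ∃ A ∈ triSet fun _ : ι => (1 : F), A ^ m = B}.ncard := by
  have hsmul : ∀ (y z : F) (A : Matrix ι ι F), A ∈ (triSet fun _ => z) →
      y • A ∈ triSet fun _ => y * z := fun y z A hA =>
    ⟨fun i j h => by simp [hA.1 i j h], fun i => by simp [hA.2 i]⟩
  rw [← Set.ncard_image_of_injective {B | ∃ A ∈ triSet fun _ : ι => (1 : F), A ^ m = B}
    (smul_right_injective _ (pow_ne_zero m hx))]
  congr 1
  ext B
  constructor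
  · rintro ⟨A, hA, rfl⟩
    refine ⟨_, ⟨x⁻¹ • A, by simpa [hx] using hsmul x⁻¹ x A hA, rfl⟩, ?_⟩
    simp [smul_pow, smul_smul, hx]
  · rintro ⟨_, ⟨A, hA, rfl⟩, rfl⟩
    exact ⟨x • A, by simpa using hsmul x 1 A hA, by simp [smul_pow]⟩

theorem ncard_triSet_one_pow_eq (m : ℕ) :
    {B | ∃ A ∈ triSet fun _ : ι => (1 : F), A ^ m = B}.ncard =
      {B | ∃ A : Matrix (Fin (Fintype.card ι)) (Fin (Fintype.card ι)) F,
        IsUnitriangular A ∧ A ^ m = B}.ncard := by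
  let φ : Fin (Fintype.card ι) ≃o ι := Fintype.orderIsoFinOfCardEq ι rfl
  let Φ := Matrix.reindexAlgEquiv F F φ.toEquiv.symm
  have hΦ : ∀ A, A ∈ (triSet fun _ : ι => (1 : F)) ↔ IsUnitriangular (Φ A) := by
    intro A
    constructor
    · exact fun hA => ⟨fun i => hA.2 _, fun i j h => hA.1 _ _ (φ.lt_iff_lt.2 h)⟩
    · refine fun hA => ⟨fun i j h => ?_, fun i => ?_⟩
      · simpa [Φ] using hA.2 (φ.symm i) (φ.symm j) (φ.symm.lt_iff_lt.2 h)
      · simpa [Φ] using hA.1 (φ.symm i)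
  rw [← Set.ncard_image_of_injective _ Φ.injective]
  congr 1
  ext B
  constructor
  · rintro ⟨_, ⟨A, hA, rfl⟩, rfl⟩
    exact ⟨Φ A, (hΦ A).1 hA, (map_pow Φ A m).symm⟩
  · rintro ⟨A, hA, rfl⟩
    refine ⟨_, ⟨Φ.symm A, (hΦ _).2 (by simpa using hA), rfl⟩, by simp⟩

theorem exists_smul_mem_blockSet [Finite F] {d : ι → κ} {e : ι → F} [Finite κ]
    (he : ∀ i j, d i ≠ d j → e i ≠ e j) :
    {y | ∃ u ∈ blockGroup (F := F) fun _ : ι => (), ∃ x ∈ blockSet d e, u • x = y} =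
      triSet e := by
  classical
  have := Fintype.ofFinite κ
  have hC : (blockSet d (1 : ι → F)).ncard = (blockSet d e).ncard := by
    rw [ncard_blockSet, ncard_blockSet]
    exact Finset.prod_congr rfl fun c _ => by rw [ncard_triSet, ncard_triSet]
  have h := ncard_conj_mul_card he subset_rfl fun c hc x hx => blockGroup_smul_mem hc hx
  rw [hC] at h
  have hpos : 0 < (blockSet d e).ncard := by
    rw [← hC]
    exact (Set.ncard_pos).2 ⟨1, one_mem_blockSet d⟩
  have h' := Nat.eq_of_mul_eq_mul_right hpos h
  refine Set.eq_of_subset_of_ncard_le ?_ ?_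
  · rintro _ ⟨u, hu, x, hx, rfl⟩
    rw [← blockSet_const]
    exact blockGroup_smul_mem hu (by rw [blockSet_const]; exact hx.1)
  · rw [h', ncard_triSet, ncard_triSet]

theorem ncard_triSet_pow_mul [Finite F] [Fintype κ] [DecidableEq κ] {d : ι → κ} {e : ι → F}
    {m : ℕ} (he : ∀ i j, d i ≠ d j → e i ^ m ≠ e j ^ m) :
    {B | ∃ A ∈ triSet e, A ^ m = B}.ncard * (blockSet d (1 : ι → F)).ncard =
      (triSet (1 : ι → F)).ncard * {B | ∃ A ∈ blockSet d e, A ^ m = B}.ncard := by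
  rw [← ncard_conj_mul_card (e := e ^ m) he]
  · congr 2
    ext B
    constructor
    · rintro ⟨A, hA, rfl⟩
      rw [← exists_smul_mem_blockSet (d := d) fun i j h h' => he i j h (by rw [h'])] at hA
      obtain ⟨u, hu, x, hx, rfl⟩ := hA
      exact ⟨u, hu, _, ⟨x, hx, rfl⟩, smul_pow' u x m⟩
    · rintro ⟨u, hu, _, ⟨x, hx, rfl⟩, rfl⟩
      refine ⟨u • x, ?_, (smul_pow' u x m).symm⟩
      rw [← exists_smul_mem_blockSet (d := d) fun i j h h' => he i j h (by rw [h'])]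
      exact ⟨u, hu, x, hx, rfl⟩
  · rintro _ ⟨A, hA, rfl⟩
    exact pow_mem_blockSet hA m
  · rintro c hc _ ⟨A, hA, rfl⟩
    exact ⟨c • A, blockGroup_smul_mem hc hA, (smul_pow' c A m).symm⟩

end TriangularSets

theorem Multiset.sum_choose_two_le (s : Multiset ℕ) :
    (s.map fun a => a.choose 2).sum ≤ s.sum.choose 2 := by
  induction s using Multiset.induction with
  | empty => simp
  | cons a s ih =>
    rw [Multiset.map_cons, Multiset.sum_cons, Multiset.sum_cons]
    refine (Nat.add_le_add_left ih _).trans ?_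
    rw [Nat.add_choose_eq, Finset.Nat.sum_antidiagonal_eq_sum_range_succ
      (fun i j => a.choose i * s.sum.choose j)]
    simp [Finset.sum_range_succ]
    omega

section PowerCount

variable {F : Type*} [Field F]

theorem ncard_triSet_units_pow_mul [Fintype F] [DecidableEq F] {ι : Type*} [Fintype ι] [LinearOrder ι]
    {p : ℕ} (hp : Function.Injective fun x : F => x ^ p) (d : ι → Fˣ) :
    {B | ∃ A ∈ triSet fun i => (d i : F), A ^ p = B}.ncard *
        ∏ c, Nat.card F ^ (Nat.card {i // d i = c}).choose 2 =
      Nat.card F ^ (Fintype.card ι).choose 2 *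
        ∏ c, {B | ∃ A : Matrix (Fin (Nat.card {i // d i = c})) (Fin (Nat.card {i // d i = c})) F,
          IsUnitriangular A ∧ A ^ p = B}.ncard := by
  classical
  have h := ncard_triSet_pow_mul (d := d) (e := fun i => (d i : F)) (m := p)
    fun i j hij h => hij (Units.ext (hp h))
  rw [ncard_triSet, ncard_blockSet, ncard_blockSet_pow] at h
  convert h using 2
  · exact Finset.prod_congr rfl fun c _ => by
      rw [ncard_triSet, Nat.card_eq_fintype_card (α := {i // d i = c})]
  · refine Finset.prod_congr rfl fun c _ => ?_
    have hc : (fun i : {i // d i = c} => (d i : F)) = fun _ => (c : F) := by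
      funext i; rw [i.2]
    rw [hc, Nat.card_eq_fintype_card]
    convert ((ncard_triSet_const_pow (ι := {i // d i = c}) c.ne_zero p).trans
      (ncard_triSet_one_pow_eq p)).symm

theorem ncard_triangular_pow [Fintype F] [DecidableEq F] {n p : ℕ}
    (hp : Function.Injective fun x : F => x ^ p) :
    {B : Matrix (Fin n) (Fin n) F | ∃ A, IsTriangular A ∧ A ^ p = B}.ncard =
      ∑ d : Fin n → Fˣ, {B | ∃ A ∈ triSet fun i => (d i : F), A ^ p = B}.ncard := by
  simp_rw [← Nat.card_coe_set_eq]
  rw [← Nat.card_sigma]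
  symm
  refine Nat.card_eq_of_bijective (fun x => ⟨x.2.1, ?_⟩) ⟨?_, ?_⟩
  · obtain ⟨d, B, A, hA, rfl⟩ := x
    exact ⟨A, ⟨hA.1, fun i => by rw [hA.2]; exact (d i).ne_zero⟩, rfl⟩
  · rintro ⟨d, B, A, hA, rfl⟩ ⟨d', B', A', hA', rfl⟩ h
    have h := congrArg Subtype.val h
    change A ^ p = A' ^ p at h
    obtain rfl : d = d' := by
      funext i
      refine Units.ext (hp ?_)
      have h1 := (pow_mem_triSet hA p).2 i
      have h2 := (pow_mem_triSet hA' p).2 i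
      rw [h] at h1
      exact h1.symm.trans h2
    congr 2
  · rintro ⟨B, A, hA, rfl⟩
    exact ⟨⟨fun i => Units.mk0 _ (hA.2 i), A ^ p, A, ⟨hA.1, fun i => rfl⟩, rfl⟩, rfl⟩

end PowerCount

/-- The partition of `n` formed by the sizes of the nonempty fibers of a function on `Fin n`. -/
noncomputable def fiberPartition {κ : Type*} [Fintype κ] {n : ℕ} (d : Fin n → κ) : n.Partition where
  parts := nonzeroValues fun c => Nat.card {i // d i = c}
  parts_pos h := Nat.pos_of_ne_zero (Multiset.mem_filter.1 h).2
  parts_sum := by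
    rw [sum_nonzeroValues, ← Nat.card_sigma, Nat.card_congr (Equiv.sigmaFiberEquiv d),
      Nat.card_fin]

theorem card_parts_fiberPartition_le {κ : Type*} [Fintype κ] {n : ℕ} (d : Fin n → κ) :
    (fiberPartition d).parts.card ≤ Fintype.card κ :=
  (Multiset.card_le_card (Multiset.filter_le _ _)).trans_eq (by simp)

theorem card_fiberPartition_eq {κ : Type*} [Fintype κ] {n : ℕ} (δ : n.Partition)
    (hδ : δ.parts.card ≤ Fintype.card κ) :
    (Nat.card {d : Fin n → κ // fiberPartition d = δ} : ℝ) =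
      (Fintype.card κ).descFactorial δ.parts.card * n.factorial /
        ∏ b ∈ Finset.Icc 1 n,
          (((δ.parts.count b).factorial : ℝ) * (b.factorial : ℝ) ^ δ.parts.count b) := by
  rw [eq_div_iff (Finset.prod_ne_zero_iff.2 fun b _ => by positivity),
    Nat.card_congr (Equiv.subtypeEquivRight fun d => Nat.Partition.ext_iff)]
  exact_mod_cast card_fiber_type_eq_mul δ hδ

theorem cast_descFactorial_pred {q : ℕ} (k : ℕ) (hk : k < q) :
    ((q - 1).descFactorial k : ℝ) = ∏ i ∈ Finset.Icc 1 k, ((q : ℝ) - i) := by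
  rw [← prod_fin_succ_eq_prod_Icc k fun i : ℕ => (q : ℝ) - i,
    Fin.prod_univ_eq_prod_range (fun i => (q : ℝ) - ((i + 1 : ℕ) : ℝ)),
    Nat.descFactorial_eq_prod_range, Nat.cast_prod]
  refine Finset.prod_congr rfl fun i hi => ?_
  rw [Finset.mem_range] at hi
  rw [Nat.sub_sub, add_comm, Nat.cast_sub (by omega)]

theorem pPowerPaper.stmt15 (p e q : ℕ) (hp : p.Prime) (he : 0 < e) (hq : q = p ^ e)
    (hq2 : 2 < q) (F : Type*) [Field F] [Fintype F] (hF : Fintype.card F = q)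
    (n : ℕ) (hn : 0 < n) :
    (Set.ncard {B : Matrix (Fin n) (Fin n) F | ∃ A, IsTriangular A ∧ A ^ p = B} : ℝ)
      = ∑ δ ∈ Finset.univ.filter (fun δ : Nat.Partition n => δ.parts.card < q),
          ((∏ i ∈ Finset.Icc 1 δ.parts.card, ((q : ℝ) - i)) * n.factorial /
              ∏ b ∈ Finset.Icc 1 n,
                (((δ.parts.count b).factorial : ℝ) * (b.factorial : ℝ) ^ δ.parts.count b)) *
          (δ.parts.map fun a =>
            (Set.ncard {B : Matrix (Fin a) (Fin a) F |
              ∃ A, IsUnitriangular A ∧ A ^ p = B} : ℝ)).prod *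
          (q : ℝ) ^ (n.choose 2 - (δ.parts.map fun a => a.choose 2).sum) := by
  classical
  have : Fact p.Prime := ⟨hp⟩
  have : CharP F p := charP_of_card_eq_prime_pow (hF.trans hq)
  have hinj : Function.Injective fun x : F => x ^ p := frobenius_inj F p
  have hunits : Fintype.card Fˣ = q - 1 := by rw [Fintype.card_units, hF]
  have hcardF : Nat.card F = q := by rw [Nat.card_eq_fintype_card, hF]
  have hq0 : (q : ℝ) ≠ 0 := by positivity
  have hterm : ∀ d : Fin n → Fˣ,
      ({B | ∃ A ∈ triSet fun i => (d i : F), A ^ p = B}.ncard : ℝ) =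
        ((fiberPartition d).parts.map fun a =>
            (Set.ncard {B : Matrix (Fin a) (Fin a) F |
              ∃ A, IsUnitriangular A ∧ A ^ p = B} : ℝ)).prod *
          (q : ℝ) ^ (n.choose 2 - ((fiberPartition d).parts.map fun a => a.choose 2).sum) := by
    intro d
    have h := ncard_triSet_units_pow_mul hinj d
    rw [hcardF, Fintype.card_fin] at h
    have hle := Multiset.sum_choose_two_le (fiberPartition d).parts
    rw [(fiberPartition d).parts_sum] at hle
    have hprod : ∏ c, q ^ (Nat.card {i // d i = c}).choose 2 =
        q ^ ((fiberPartition d).parts.map fun a => a.choose 2).sum := by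
      rw [← prod_map_nonzeroValues (fun c => Nat.card {i // d i = c})
        (fun a => q ^ a.choose 2) (by simp)]
      change ((fiberPartition d).parts.map fun a => q ^ a.choose 2).prod = _
      induction (fiberPartition d).parts using Multiset.induction with
      | empty => simp
      | cons a s ih => simp [ih, pow_add]
    have hU : ((fiberPartition d).parts.map fun a =>
            (Set.ncard {B : Matrix (Fin a) (Fin a) F |
              ∃ A, IsUnitriangular A ∧ A ^ p = B} : ℝ)).prod = _ :=
      prod_map_nonzeroValues (fun c => Nat.card {i // d i = c}) _ (by
        rw [Nat.cast_eq_one, Set.ncard_eq_one]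
        refine ⟨1, Set.eq_singleton_iff_unique_mem.2 ⟨⟨1, ⟨fun i => i.elim0, fun i => i.elim0⟩,
          one_pow p⟩, fun B _ => Subsingleton.elim _ _⟩⟩)
    rw [hU]
    refine mul_right_cancel₀ (pow_ne_zero
      ((fiberPartition d).parts.map fun a => a.choose 2).sum hq0) ?_
    rw [mul_assoc, ← pow_add, Nat.sub_add_cancel hle, mul_comm (∏ c, _)]
    rw [hprod] at h
    exact_mod_cast h
  rw [ncard_triangular_pow hinj, Nat.cast_sum, Finset.sum_congr rfl fun d _ => hterm d,
    ← Finset.sum_fiberwise_of_maps_to (g := fiberPartition)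
      (t := Finset.univ.filter fun δ : Nat.Partition n => δ.parts.card < q)]
  · refine Finset.sum_congr rfl fun δ hδ => ?_
    rw [Finset.mem_filter] at hδ
    rw [← cast_descFactorial_pred _ hδ.2, ← hunits, ← card_fiberPartition_eq δ (by omega),
      Nat.card_eq_fintype_card, Fintype.card_subtype, mul_assoc, ← nsmul_eq_mul]
    refine Finset.sum_eq_card_nsmul fun d hd => ?_
    rw [(Finset.mem_filter.1 hd).2]
  · intro d _
    have := card_parts_fiberPartition_le d
    simp only [Finset.mem_filter, Finset.mem_univ, true_and]
    omega
end

section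
/- Let p be a prime, n an integer, and q a power of p such that q > n−p−1. Then for T = T(n,q): |T^p| / |T| ≥ 2^{n−2} / ( 9 (q−1)^{n−2} q^{(p−1)(n−p)} ). -/
namespace TriangularPower

open Matrix Module

section Border

variable {F : Type*} [Field F] {n : ℕ}

/-- The matrix with upper left block `A`, last row `(v, a)`, and zeros above the corner `a`. -/
def border (A : Matrix (Fin n) (Fin n) F) (v : Fin n → F) (a : F) :
    Matrix (Fin (n + 1)) (Fin (n + 1)) F :=
  Matrix.of fun i j => Fin.lastCases (motive := fun _ => F)
    (Fin.lastCases (motive := fun _ => F) a v j)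
    (fun i' => Fin.lastCases (motive := fun _ => F) 0 (A i') j) i

@[simp] lemma border_last_last (A : Matrix (Fin n) (Fin n) F) (v : Fin n → F) (a : F) :
    border A v a (Fin.last n) (Fin.last n) = a := by simp [border]

@[simp] lemma border_last_castSucc (A : Matrix (Fin n) (Fin n) F) (v : Fin n → F) (a : F)
    (j : Fin n) : border A v a (Fin.last n) j.castSucc = v j := by simp [border]

@[simp] lemma border_castSucc_last (A : Matrix (Fin n) (Fin n) F) (v : Fin n → F) (a : F)
    (i : Fin n) : border A v a i.castSucc (Fin.last n) = 0 := by simp [border]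

@[simp] lemma border_castSucc_castSucc (A : Matrix (Fin n) (Fin n) F) (v : Fin n → F) (a : F)
    (i j : Fin n) : border A v a i.castSucc j.castSucc = A i j := by simp [border]

lemma border_inj {A A' : Matrix (Fin n) (Fin n) F} {v v' : Fin n → F} {a a' : F}
    (h : border A v a = border A' v' a') : A = A' ∧ v = v' ∧ a = a' := by
  refine ⟨?_, ?_, ?_⟩
  · ext i j
    simpa using congrFun (congrFun h i.castSucc) j.castSucc
  · ext j
    simpa using congrFun (congrFun h (Fin.last n)) j.castSucc
  · simpa using congrFun (congrFun h (Fin.last n)) (Fin.last n)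

lemma border_one : border (1 : Matrix (Fin n) (Fin n) F) 0 1 = 1 := by
  ext i j
  induction i using Fin.lastCases <;> induction j using Fin.lastCases <;>
    simp [Matrix.one_apply, Fin.castSucc_ne_last, (Fin.castSucc_ne_last _).symm]

lemma border_mul (A A' : Matrix (Fin n) (Fin n) F) (v v' : Fin n → F) (a a' : F) :
    border A v a * border A' v' a' = border (A * A') (v ᵥ* A' + a • v') (a * a') := by
  ext i j
  induction i using Fin.lastCases <;> induction j using Fin.lastCases <;>
    simp [Matrix.mul_apply, Fin.sum_univ_castSucc, Matrix.vecMul, dotProduct]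

lemma border_vecMul_sub_pow (A : Matrix (Fin n) (Fin n) F) (w : Fin n → F) (a : F) (k : ℕ) :
    border A (w ᵥ* A - a • w) a ^ k = border (A ^ k) (w ᵥ* A ^ k - a ^ k • w) (a ^ k) := by
  induction k with
  | zero => simp [border_one]
  | succ k ih =>
    rw [pow_succ, ih, border_mul, ← pow_succ, ← pow_succ]
    congr 1
    rw [Matrix.sub_vecMul, Matrix.vecMul_vecMul, ← pow_succ, Matrix.smul_vecMul, smul_sub,
      smul_smul, ← pow_succ]
    abel

lemma isTriangular_border {A : Matrix (Fin n) (Fin n) F} (hA : IsTriangular A) (v : Fin n → F)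
    {a : F} (ha : a ≠ 0) : IsTriangular (border A v a) := by
  refine ⟨fun i j hij => ?_, fun i => ?_⟩
  · induction i using Fin.lastCases with
    | last => exact absurd hij (not_lt.mpr (Fin.le_last j))
    | cast i =>
      induction j using Fin.lastCases with
      | last => simp
      | cast j => simpa using hA.1 i j (by simpa using hij)
  · induction i using Fin.lastCases with
    | last => simpa using ha
    | cast i => simpa using hA.2 i

end Border

section Triangular

variable {F : Type*} [Field F] {n : ℕ}

lemma isTriangular_one : IsTriangular (1 : Matrix (Fin n) (Fin n) F) :=
  ⟨fun _ _ h => Matrix.one_apply_ne h.ne, fun i => by simp⟩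

lemma isTriangular_mul {A B : Matrix (Fin n) (Fin n) F} (hA : IsTriangular A)
    (hB : IsTriangular B) : IsTriangular (A * B) := by
  refine ⟨fun i j hij => ?_, fun i => ?_⟩
  · rw [Matrix.mul_apply]
    refine Finset.sum_eq_zero fun k _ => ?_
    rcases lt_or_ge i k with h | h
    · rw [hA.1 i k h, zero_mul]
    · rw [hB.1 k j (h.trans_lt hij), mul_zero]
  · rw [Matrix.mul_apply, Finset.sum_eq_single i]
    · exact mul_ne_zero (hA.2 i) (hB.2 i)
    · intro k _ hk
      rcases lt_or_gt_of_ne hk with h | h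
      · rw [hB.1 k i h, mul_zero]
      · rw [hA.1 i k h, zero_mul]
    · simp

lemma isTriangular_pow {A : Matrix (Fin n) (Fin n) F} (hA : IsTriangular A) (k : ℕ) :
    IsTriangular (A ^ k) := by
  induction k with
  | zero => simpa using isTriangular_one
  | succ k ih => rw [pow_succ]; exact isTriangular_mul ih hA

end Triangular

lemma sum_finrank_eigenspace_le {K V ι : Type*} [Field K] [AddCommGroup V] [Module K V]
    [FiniteDimensional K V] [Fintype ι] (f : End K V) {μ : ι → K} (hμ : Function.Injective μ) :
    ∑ i, finrank K (f.eigenspace (μ i)) ≤ finrank K V := by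
  classical
  have h := (f.eigenspaces_iSupIndep.comp hμ).dfinsupp_lsum_injective
  rw [← Module.finrank_directSum]
  exact LinearMap.finrank_le_finrank_of_injective h

section Counting

variable (F : Type*) [Field F] [Fintype F] (n : ℕ)

/-- The number of invertible lower triangular `n × n` matrices. -/
noncomputable def cardTriangular (F : Type*) [Field F] (n : ℕ) : ℕ :=
  Nat.card {A : Matrix (Fin n) (Fin n) F // IsTriangular A}

/-- The number of split semisimple invertible lower triangular `n × n` matrices. -/
noncomputable def cardSemisimple : ℕ :=
  Nat.card {A : Matrix (Fin n) (Fin n) F // IsTriangular A ∧ A ^ Fintype.card F = A}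

lemma cardTriangular_pos : 0 < cardTriangular F n :=
  have : Nonempty {A : Matrix (Fin n) (Fin n) F // IsTriangular A} := ⟨1, isTriangular_one⟩
  Nat.card_pos

lemma cardTriangular_zero (F : Type*) [Field F] : cardTriangular F 0 = 1 := by
  have : Nonempty {A : Matrix (Fin 0) (Fin 0) F // IsTriangular A} := ⟨1, isTriangular_one⟩
  exact Nat.card_unique

lemma cardSemisimple_zero : cardSemisimple F 0 = 1 := by
  have : Nonempty {A : Matrix (Fin 0) (Fin 0) F // IsTriangular A ∧ A ^ Fintype.card F = A} :=
    ⟨1, isTriangular_one, one_pow _⟩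
  exact Nat.card_unique

lemma cardTriangular_succ_le :
    cardTriangular F (n + 1) ≤
      cardTriangular F n * (Fintype.card F ^ n * (Fintype.card F - 1)) := by
  classical
  have hcard : Nat.card ({A : Matrix (Fin n) (Fin n) F // IsTriangular A} ×
      ((Fin n → F) × Fˣ)) =
      cardTriangular F n * (Fintype.card F ^ n * (Fintype.card F - 1)) := by
    rw [Nat.card_prod, Nat.card_prod, cardTriangular, Nat.card_units, Nat.card_fun]
    simp
  rw [← hcard]
  refine Nat.card_le_card_of_injective
    (fun A => (⟨A.1.submatrix Fin.castSucc Fin.castSucc,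
        fun i j h => A.2.1 _ _ (by simpa using h), fun i => A.2.2 _⟩,
      fun j => A.1 (Fin.last n) j.castSucc, Units.mk0 _ (A.2.2 (Fin.last n)))) ?_
  rintro ⟨A, hA⟩ ⟨B, hB⟩ h
  simp only [Prod.mk.injEq, Units.mk0_inj] at h
  obtain ⟨h₁, h₂, h₃⟩ := h
  refine Subtype.ext ?_
  ext i j
  induction i using Fin.lastCases with
  | last =>
    induction j using Fin.lastCases with
    | last => exact h₃
    | cast j => exact congrFun h₂ j
  | cast i =>
    induction j using Fin.lastCases with
    | last =>
      change A _ _ = B _ _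
      rw [hA.1 _ _ (Fin.castSucc_lt_last i), hB.1 _ _ (Fin.castSucc_lt_last i)]
    | cast j => exact congrFun (congrFun (congrArg Subtype.val h₁) i) j

variable {n} in
lemma mul_cardSemisimple_le [DecidableEq F] {c : ℝ}
    (hc : ∀ A : Matrix (Fin n) (Fin n) F, c ≤ ∑ a : Fˣ, (Fintype.card F : ℝ) ^
      finrank F (LinearMap.range (Matrix.vecMulLinear A - (a : F) • (1 : End F (Fin n → F))))) :
    cardSemisimple F n * c ≤ cardSemisimple F (n + 1) := by
  classical
  have hcard : ∀ (A : Matrix (Fin n) (Fin n) F) (a : Fˣ), (Fintype.card F : ℝ) ^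
      finrank F (LinearMap.range (Matrix.vecMulLinear A - (a : F) • (1 : End F (Fin n → F)))) =
      (Nat.card (LinearMap.range
        (Matrix.vecMulLinear A - (a : F) • (1 : End F (Fin n → F)))) : ℕ) := by
    intro A a
    rw [Module.natCard_eq_pow_finrank (K := F), Nat.card_eq_fintype_card]
    push_cast
    rfl
  have hsum : (cardSemisimple F n : ℝ) * c ≤
      ((∑ A : {A : Matrix (Fin n) (Fin n) F // IsTriangular A ∧ A ^ Fintype.card F = A},
        ∑ a : Fˣ, Nat.card (LinearMap.range
          (Matrix.vecMulLinear A.1 - (a : F) • (1 : End F (Fin n → F)))) : ℕ) : ℝ) := by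
    push_cast
    simp only [← hcard]
    have := Finset.card_nsmul_le_sum Finset.univ
      (fun A : {A : Matrix (Fin n) (Fin n) F // IsTriangular A ∧ A ^ Fintype.card F = A} =>
        ∑ a : Fˣ, (Fintype.card F : ℝ) ^ finrank F (LinearMap.range
          (Matrix.vecMulLinear A.1 - (a : F) • (1 : End F (Fin n → F))))) c (fun A _ => hc A.1)
    rwa [Finset.card_univ, nsmul_eq_mul, ← Nat.card_eq_fintype_card] at this
  refine hsum.trans (Nat.cast_le.mpr ?_)
  simp only [← Nat.card_sigma]
  refine Nat.card_le_card_of_injective (fun x => ⟨border x.1.1 x.2.2.1 x.2.1,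
    isTriangular_border x.1.2.1 _ x.2.1.ne_zero, ?_⟩) ?_
  · obtain ⟨⟨A, hA, hAq⟩, a, ⟨v, w, rfl⟩⟩ := x
    have := border_vecMul_sub_pow A w (a : F) (Fintype.card F)
    rw [hAq, FiniteField.pow_card] at this
    exact this
  · rintro ⟨⟨A, hA⟩, a, ⟨v, hv⟩⟩ ⟨⟨B, hB⟩, b, ⟨w, hw⟩⟩ h
    obtain ⟨h₁, h₂, h₃⟩ := border_inj (Subtype.mk.inj h)
    dsimp only at h₁ h₂ h₃
    obtain rfl := Units.ext h₃
    subst h₁ h₂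
    rfl

lemma pow_tangent_le {x : ℝ} (hx₀ : 0 < x) (j m : ℕ) :
    x ^ j * (1 - ((m : ℝ) - j) * (1 - x)) ≤ x ^ m := by
  rcases le_total j m with h | h
  · obtain ⟨d, rfl⟩ := Nat.exists_eq_add_of_le h
    rw [pow_add]
    refine mul_le_mul_of_nonneg_left ?_ (by positivity)
    have := one_add_mul_le_pow (a := x - 1) (by linarith) d
    push_cast
    calc _ = 1 + (d : ℝ) * (x - 1) := by ring
      _ ≤ _ := this
      _ = _ := by ring
  · obtain ⟨d, rfl⟩ := Nat.exists_eq_add_of_le h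
    rw [pow_add, mul_assoc]
    refine mul_le_of_le_one_right (by positivity) ?_
    push_cast
    have key : ∀ d : ℕ, x ^ d * (1 + d * (1 - x)) ≤ 1 := by
      intro d
      induction d with
      | zero => simp
      | succ d ih =>
        have : x ^ (d + 1) * (1 + ((d + 1 : ℕ) : ℝ) * (1 - x)) ≤ x ^ d * (1 + d * (1 - x)) := by
          rw [pow_succ, mul_assoc]
          refine mul_le_mul_of_nonneg_left ?_ (by positivity)
          push_cast
          have : (0 : ℝ) ≤ (d + 1) * (1 - x) ^ 2 := by positivity
          nlinarith
        exact this.trans ih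
    calc _ = x ^ d * (1 + d * (1 - x)) := by ring
      _ ≤ 1 := key d

/-- A lower bound on the proportion of split semisimple extensions of a matrix by one row: the
tangent line at `j` of `m ↦ q ^ (-m)`, applied to the average multiplicity of an eigenvalue. -/
lemma sum_pow_finrank_range_ge [DecidableEq F] (A : Matrix (Fin n) (Fin n) F) (j : ℕ) :
    (Fintype.card F : ℝ) ^ n * (Fintype.card F - 1) *
        ((Fintype.card F + j * ((Fintype.card F : ℝ) - 1) - n) / (Fintype.card F : ℝ) ^ (j + 1)) ≤
      ∑ a : Fˣ, (Fintype.card F : ℝ) ^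
        finrank F (LinearMap.range
          (Matrix.vecMulLinear A - (a : F) • (1 : End F (Fin n → F)))) := by
  set q : ℝ := (Fintype.card F : ℝ)
  have hq1 : (1 : ℝ) < q := Nat.one_lt_cast.mpr Fintype.one_lt_card
  have hq0 : (0 : ℝ) < q := by linarith
  set m : Fˣ → ℕ := fun a => finrank F (End.eigenspace (Matrix.vecMulLinear A) (a : F))
  have hsum : (∑ a, (m a : ℝ)) ≤ n := by
    have := sum_finrank_eigenspace_le (Matrix.vecMulLinear A)
      (μ := fun a : Fˣ => (a : F)) Units.val_injective
    rw [Module.finrank_fin_fun] at this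
    rw [← Nat.cast_sum]
    exact Nat.cast_le.mpr this
  have hterm : ∀ a : Fˣ, q ^ n * (q⁻¹ ^ j * (1 - ((m a : ℝ) - j) * (1 - q⁻¹))) ≤ q ^
      finrank F (LinearMap.range
        (Matrix.vecMulLinear A - (a : F) • (1 : End F (Fin n → F)))) := by
    intro a
    have hrank := LinearMap.finrank_range_add_finrank_ker
      (Matrix.vecMulLinear A - (a : F) • (1 : End F (Fin n → F)))
    rw [← Module.End.eigenspace_def, Module.finrank_fin_fun] at hrank
    calc _ ≤ q ^ n * q⁻¹ ^ m a := by
          gcongr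
          exact pow_tangent_le (inv_pos.mpr hq0) j (m a)
      _ = _ := by
          have hpow : q ^ n = q ^ finrank F (LinearMap.range
              (Matrix.vecMulLinear A - (a : F) • (1 : End F (Fin n → F)))) * q ^ m a := by
            rw [← pow_add, hrank]
          rw [hpow, inv_pow, mul_assoc, mul_inv_cancel₀ (by positivity), mul_one]
  refine le_trans ?_ (Finset.sum_le_sum fun a _ => hterm a)
  have hunits : (Fintype.card Fˣ : ℝ) = q - 1 := by
    rw [Fintype.card_units, Nat.cast_sub Fintype.card_pos, Nat.cast_one]
  have hexpand : ∑ a : Fˣ, q ^ n * (q⁻¹ ^ j * (1 - ((m a : ℝ) - j) * (1 - q⁻¹))) =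
      q ^ n * q⁻¹ ^ j * ((q - 1) - (∑ a, (m a : ℝ) - (q - 1) * j) * (1 - q⁻¹)) := by
    rw [← Finset.mul_sum, ← Finset.mul_sum, Finset.sum_sub_distrib, ← Finset.sum_mul,
      Finset.sum_sub_distrib]
    simp only [Finset.sum_const, Finset.card_univ, nsmul_eq_mul, hunits]
    ring
  rw [hexpand]
  calc _ = q ^ n * q⁻¹ ^ j * ((q - 1) - (n - (q - 1) * j) * (1 - q⁻¹)) := by
        rw [inv_pow]
        field_simp
        ring
    _ ≤ _ := by
        have : 0 ≤ 1 - q⁻¹ := sub_nonneg.mpr (inv_le_one_of_one_le₀ hq1.le)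
        gcongr

/-- The proportion of split semisimple matrices among the invertible lower triangular ones. -/
noncomputable def semisimpleRatio : ℝ := cardSemisimple F n / cardTriangular F n

lemma semisimpleRatio_nonneg : 0 ≤ semisimpleRatio F n := by
  unfold semisimpleRatio
  positivity

lemma semisimpleRatio_zero : semisimpleRatio F 0 = 1 := by
  simp [semisimpleRatio, cardSemisimple_zero, cardTriangular_zero]

lemma semisimpleRatio_succ_ge (j : ℕ) :
    semisimpleRatio F n *
        ((Fintype.card F + j * ((Fintype.card F : ℝ) - 1) - n) / (Fintype.card F : ℝ) ^ (j + 1)) ≤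
      semisimpleRatio F (n + 1) := by
  classical
  set r : ℝ :=
    (Fintype.card F + j * ((Fintype.card F : ℝ) - 1) - n) / (Fintype.card F : ℝ) ^ (j + 1) with hr
  rcases le_or_gt r 0 with h0 | h0
  · exact (mul_nonpos_of_nonneg_of_nonpos (semisimpleRatio_nonneg F n) h0).trans
      (semisimpleRatio_nonneg F _)
  have hq1 : (1 : ℝ) < Fintype.card F := by exact_mod_cast Fintype.one_lt_card (α := F)
  have hN := mul_cardSemisimple_le F (fun A => sum_pow_finrank_range_ge F n A j)
  rw [← hr] at hN
  have hT : (cardTriangular F (n + 1) : ℝ) ≤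
      cardTriangular F n * ((Fintype.card F : ℝ) ^ n * (Fintype.card F - 1)) := by
    have := cardTriangular_succ_le F n
    rw [← Nat.cast_le (α := ℝ)] at this
    push_cast [Nat.cast_sub (Fintype.card_pos (α := F))] at this
    exact this
  have hT0 : (0 : ℝ) < cardTriangular F n := Nat.cast_pos.mpr (cardTriangular_pos F n)
  have hT1 : (0 : ℝ) < cardTriangular F (n + 1) := Nat.cast_pos.mpr (cardTriangular_pos F _)
  unfold semisimpleRatio
  rw [le_div_iff₀ hT1]
  calc _ ≤ (cardSemisimple F n : ℝ) / cardTriangular F n * r *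
        (cardTriangular F n * ((Fintype.card F : ℝ) ^ n * (Fintype.card F - 1))) := by gcongr
    _ = cardSemisimple F n * ((Fintype.card F : ℝ) ^ n * (Fintype.card F - 1) * r) := by
        field_simp
    _ ≤ _ := hN

end Counting

section Numerics

/-- The lower bound of the main theorem. -/
noncomputable def powerBound (p q n : ℕ) : ℝ :=
  2 ^ (n - 2) / (9 * ((q : ℝ) - 1) ^ (n - 2) * (q : ℝ) ^ ((p - 1) * (n - p)))

lemma powerBound_nonneg {p q n : ℕ} (hq : 1 ≤ q) : 0 ≤ powerBound p q n := by
  have : (0 : ℝ) ≤ (q : ℝ) - 1 := sub_nonneg.mpr (Nat.one_le_cast.mpr hq)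
  unfold powerBound
  positivity

lemma powerBound_of_le_two {p q n : ℕ} (hn : n ≤ 2) (hp : 2 ≤ p) : powerBound p q n = 1 / 9 := by
  simp [powerBound, Nat.sub_eq_zero_of_le hn, Nat.sub_eq_zero_of_le (hn.trans hp)]

lemma powerBound_succ_of_lt {p q k : ℕ} (hq : 1 < q) (hk : 2 ≤ k) (hkp : k < p) :
    powerBound p q (k + 1) = powerBound p q k * (2 / ((q : ℝ) - 1)) := by
  have hq1 : (0 : ℝ) < (q : ℝ) - 1 := sub_pos.mpr (Nat.one_lt_cast.mpr hq)
  have h1 : k + 1 - 2 = (k - 2) + 1 := by omega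
  have h2 : k + 1 - p = 0 := by omega
  have h3 : k - p = 0 := by omega
  simp only [powerBound, h1, h2, h3, pow_succ]
  field_simp

lemma powerBound_succ_of_le {p q k : ℕ} (hq : 1 < q) (hk : 2 ≤ k) (hkp : p ≤ k) :
    powerBound p q (k + 1) = powerBound p q k * (2 / (((q : ℝ) - 1) * (q : ℝ) ^ (p - 1))) := by
  have hq1 : (0 : ℝ) < (q : ℝ) - 1 := sub_pos.mpr (Nat.one_lt_cast.mpr hq)
  have h1 : k + 1 - 2 = (k - 2) + 1 := by omega
  have h2 : k + 1 - p = (k - p) + 1 := by omega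
  simp only [powerBound, h1, h2, pow_succ, mul_add, mul_one, pow_add]
  field_simp

variable {X : ℕ → ℝ} {p q : ℕ}

lemma one_le_and_sub_div_le_of_step (h0 : X 0 = 1) (hq : 1 < q)
    (hstep : ∀ k j : ℕ, X k * ((q + j * ((q : ℝ) - 1) - k) / (q : ℝ) ^ (j + 1)) ≤ X (k + 1)) :
    1 ≤ X 1 ∧ ((q : ℝ) - 1) / q ≤ X 2 := by
  have hq0 : (1 : ℝ) < q := Nat.one_lt_cast.mpr hq
  have h1 : 1 ≤ X 1 := by
    have := hstep 0 0
    simp only [h0, Nat.cast_zero] at this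
    simpa [div_self (by positivity : (q : ℝ) ≠ 0)] using this
  refine ⟨h1, ?_⟩
  have := hstep 1 0
  simp only [Nat.cast_zero, Nat.cast_one, zero_mul, add_zero, zero_add, pow_one] at this
  refine le_trans ?_ this
  exact le_mul_of_one_le_left (div_nonneg (by linarith) (by linarith)) h1

lemma step_ge (hX : ∀ k, 0 ≤ X k) {B B' c r s t : ℝ} {k : ℕ}
    (hstep : X k * r ≤ X (k + 1)) (h : c * B ≤ X k) (hB' : B' = B * s)
    (hr : t * s ≤ r) (hs : 0 ≤ s) (ht : 0 ≤ t) : c * t * B' ≤ X (k + 1) := by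
  refine le_trans ?_ hstep
  calc c * t * B' = (c * B) * (t * s) := by rw [hB']; ring
    _ ≤ X k * r := mul_le_mul h hr (by positivity) (hX k)

lemma powerBound_le_of_le_prime (hX : ∀ k, 0 ≤ X k) (h0 : X 0 = 1)
    (hstep : ∀ k j : ℕ, X k * ((q + j * ((q : ℝ) - 1) - k) / (q : ℝ) ^ (j + 1)) ≤ X (k + 1))
    (hp : 2 ≤ p) (hpq : p = q ∨ 2 * p ≤ q) (hq : 5 ≤ q) {n : ℕ} (hn : 2 ≤ n) (hnp : n ≤ p) :
    powerBound p q n ≤ X n := by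
  have hq5 : (5 : ℝ) ≤ q := by exact_mod_cast hq
  have hs : (0 : ℝ) ≤ 2 / ((q : ℝ) - 1) := div_nonneg (by norm_num) (by linarith)
  have hstep0 : ∀ k : ℕ, X k * ((q - k) / q) ≤ X (k + 1) := by
    intro k
    simpa using hstep k 0
  have hpos : ∀ n, 0 ≤ powerBound p q n := fun n => powerBound_nonneg (by omega)
  have hsmall : ∀ n : ℕ, 2 ≤ n → n ≤ p → n + 2 ≤ q → 7 * powerBound p q n ≤ X n := by
    intro n hn
    induction n, hn using Nat.le_induction with
    | base =>
      intro _ _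
      rw [powerBound_of_le_two le_rfl hp]
      refine le_trans ?_ (one_le_and_sub_div_le_of_step h0 (by omega) hstep).2
      rw [le_div_iff₀ (by linarith)]
      linarith
    | succ k hk ih =>
      intro hkp hkq
      have hkq' : (k : ℝ) + 3 ≤ q := by exact_mod_cast hkq
      have := step_ge (t := 1) hX (hstep0 k) (ih (by omega) (by omega))
        (powerBound_succ_of_lt (by omega) hk hkp) ?_ hs zero_le_one
      · simpa using this
      · rw [one_mul, div_le_div_iff₀ (by linarith) (by linarith)]
        nlinarith
  rcases Nat.lt_or_ge q (n + 2) with hlt | hge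
  · have hpen : p = q → 7 * (4 / 5) * powerBound p q (q - 2 + 1) ≤ X (q - 2 + 1) := by
      intro hpq
      refine step_ge hX (hstep0 (q - 2)) (hsmall (q - 2) (by omega) (by omega) (by omega))
        (powerBound_succ_of_lt (by omega) (by omega) (by omega)) ?_ hs (by norm_num)
      rw [Nat.cast_sub (by omega), ← mul_div_assoc, div_le_div_iff₀ (by linarith) (by linarith)]
      push_cast
      nlinarith
    by_cases hnq : n = q
    · have hpq : p = q := by omega
      have hlast := hpen hpq
      have e : q - 2 + 1 = q - 1 := by omega
      rw [e] at hlast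
      have := step_ge (t := 2 / 5) hX (hstep0 (q - 1)) hlast
        (powerBound_succ_of_lt (by omega) (by omega) (by omega)) ?_ hs (by norm_num)
      · have e' : q - 1 + 1 = n := by omega
        rw [e'] at this
        linarith [hpos n]
      · rw [Nat.cast_sub (by omega), ← mul_div_assoc, div_le_div_iff₀ (by linarith) (by linarith)]
        push_cast
        nlinarith
    · by_cases hpq' : p = q
      · have hlast := hpen hpq'
        have e : q - 2 + 1 = n := by omega
        rw [e] at hlast
        linarith [hpos n]
      · omega
  · linarith [hsmall n hn hnp hge, hpos n]

lemma powerBound_le_of_five_le (hX : ∀ k, 0 ≤ X k) (h0 : X 0 = 1)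
    (hstep : ∀ k j : ℕ, X k * ((q + j * ((q : ℝ) - 1) - k) / (q : ℝ) ^ (j + 1)) ≤ X (k + 1))
    (hp : 2 ≤ p) (hpq : p = q ∨ 2 * p ≤ q) (hq : 5 ≤ q) {n : ℕ} (hn : 2 ≤ n) (hnq : n ≤ q + p) :
    powerBound p q n ≤ X n := by
  rcases le_total n p with hnp | hnp
  · exact powerBound_le_of_le_prime hX h0 hstep hp hpq hq hn hnp
  have hq5 : (5 : ℝ) ≤ q := by exact_mod_cast hq
  have hpos : ∀ n, 0 ≤ powerBound p q n := fun n => powerBound_nonneg (by omega)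
  induction n, hnp using Nat.le_induction with
  | base => exact powerBound_le_of_le_prime hX h0 hstep hp hpq hq hp le_rfl
  | succ k hk ih =>
    have hs : (0 : ℝ) ≤ 2 / (((q : ℝ) - 1) * (q : ℝ) ^ (p - 1)) :=
      div_nonneg (by norm_num) (mul_nonneg (by linarith) (by positivity))
    suffices h : ∃ j : ℕ, 2 / (((q : ℝ) - 1) * (q : ℝ) ^ (p - 1)) ≤
        (q + j * ((q : ℝ) - 1) - k) / (q : ℝ) ^ (j + 1) by
      obtain ⟨j, hj⟩ := h
      have := step_ge (t := 1) (c := 1) hX (hstep k j)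
        (by simpa using ih (by omega) (by omega))
        (powerBound_succ_of_le (by omega) (by omega) hk) (by simpa using hj) hs
        zero_le_one
      simpa using this
    have hweak : 2 / (((q : ℝ) - 1) * (q : ℝ) ^ (p - 1)) ≤ 2 / (((q : ℝ) - 1) * q) := by
      have h1 : (q : ℝ) ≤ (q : ℝ) ^ (p - 1) := le_self_pow₀ (by linarith) (by omega)
      have h2 : (0 : ℝ) < (q : ℝ) - 1 := by linarith
      gcongr
    rcases Nat.lt_or_ge k q with hkq | hkq
    · refine ⟨0, hweak.trans ?_⟩
      have hkq' : (k : ℝ) + 1 ≤ q := by exact_mod_cast hkq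
      rw [div_le_div_iff₀ (by nlinarith) (by positivity)]
      norm_num
      have : (4 : ℝ) * q ≤ (q - 1) * q := by nlinarith
      nlinarith
    rcases hpq with hpq | hpq
    · have hstrong : 2 / (((q : ℝ) - 1) * (q : ℝ) ^ (p - 1)) ≤ 2 / (((q : ℝ) - 1) * q ^ 4) := by
        have h1 : (q : ℝ) ^ 4 ≤ (q : ℝ) ^ (p - 1) := pow_le_pow_right₀ (by linarith) (by omega)
        have h2 : (0 : ℝ) < (q : ℝ) - 1 := by linarith
        gcongr
      have hq1 : (0 : ℝ) < (q : ℝ) - 1 := by linarith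
      by_cases hlast : k + 2 ≤ 2 * q
      · refine ⟨1, hstrong.trans ?_⟩
        have hk' : (k : ℝ) + 2 ≤ 2 * q := by exact_mod_cast hlast
        calc 2 / (((q : ℝ) - 1) * q ^ 4) ≤ 1 / q ^ 2 := by
              rw [div_le_div_iff₀ (by positivity) (by positivity)]
              have h4 : 2 ≤ ((q : ℝ) - 1) * q ^ 2 := by nlinarith
              nlinarith [mul_le_mul_of_nonneg_right h4 (sq_nonneg (q : ℝ))]
          _ ≤ _ := by
              refine div_le_div_of_nonneg_right ?_ (by positivity)
              push_cast
              linarith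
      · refine ⟨2, hstrong.trans ?_⟩
        have hk' : (k : ℝ) + 1 = 2 * q := by
          have : k + 1 = 2 * q := by omega
          exact_mod_cast this
        have e : (q : ℝ) + ((2 : ℕ) : ℝ) * ((q : ℝ) - 1) - k = q - 1 := by
          push_cast
          linarith
        rw [e, div_le_div_iff₀ (by positivity) (by positivity)]
        norm_num
        have h4 : 2 ≤ ((q : ℝ) - 1) * ((q : ℝ) - 1) * q := by nlinarith
        nlinarith [mul_le_mul_of_nonneg_right h4 (by positivity : (0 : ℝ) ≤ (q : ℝ) ^ 3)]
    · refine ⟨1, hweak.trans ?_⟩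
      have hk' : (k : ℝ) + 1 ≤ q + p := by exact_mod_cast hnq
      have hp' : 2 * (p : ℝ) ≤ q := by exact_mod_cast hpq
      have hq1 : (0 : ℝ) < (q : ℝ) - 1 := by linarith
      calc 2 / (((q : ℝ) - 1) * q) ≤ (q / 2) / q ^ 2 := by
            rw [div_le_div_iff₀ (by positivity) (by positivity)]
            nlinarith [mul_nonneg (sq_nonneg (q : ℝ)) (by linarith : (0 : ℝ) ≤ (q : ℝ) - 5)]
        _ ≤ _ := by
            refine div_le_div_of_nonneg_right ?_ (by positivity)
            push_cast
            linarith

lemma powerBound_le (hX : ∀ k, 0 ≤ X k) (h0 : X 0 = 1)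
    (hstep : ∀ k j : ℕ, X k * ((q + j * ((q : ℝ) - 1) - k) / (q : ℝ) ^ (j + 1)) ≤ X (k + 1))
    (hp : p.Prime) (hpq : p = q ∨ 2 * p ≤ q) {n : ℕ} (hnq : n ≤ q + p)
    (hexc : ¬(q = 2 ∧ n = 4)) : powerBound p q n ≤ X n := by
  have hp2 := hp.two_le
  obtain ⟨hX1, hX2⟩ := one_le_and_sub_div_le_of_step h0 (by omega) hstep
  rcases Nat.lt_or_ge n 2 with hn | hn
  · rw [powerBound_of_le_two (by omega) hp.two_le]
    interval_cases n
    · rw [h0]; norm_num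
    · linarith
  rcases Nat.lt_or_ge q 5 with hq | hq
  · have h20 := hstep 2 0
    have h21 := hstep 2 1
    have h30 := hstep 3 0
    have h31 := hstep 3 1
    have h41 := hstep 4 1
    have h51 := hstep 5 1
    have h52 := hstep 5 2
    have hq2 : 2 ≤ q := by omega
    interval_cases q
    · obtain rfl : p = 2 := by omega
      norm_num at *
      interval_cases n <;> norm_num [powerBound] at * <;> linarith
    · obtain rfl : p = 3 := by omega
      norm_num at *
      interval_cases n <;> norm_num [powerBound] <;> linarith
    · have hp4 : p ≠ 4 := by rintro rfl; revert hp; decide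
      obtain rfl : p = 2 := by omega
      norm_num at *
      interval_cases n <;> norm_num [powerBound] <;> linarith
  · exact powerBound_le_of_five_le hX h0 hstep hp.two_le hpq hq hn hnq

end Numerics

section Powers

variable (F : Type*) [Field F] [Fintype F]

lemma cardSemisimple_le_ncard_pow {p e n : ℕ} (he : 0 < e) (hF : Fintype.card F = p ^ e) :
    cardSemisimple F n ≤
      Set.ncard {B : Matrix (Fin n) (Fin n) F | ∃ A, IsTriangular A ∧ A ^ p = B} := by
  change Set.ncard {A : Matrix (Fin n) (Fin n) F | IsTriangular A ∧ A ^ Fintype.card F = A} ≤ _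
  refine Set.ncard_le_ncard ?_ (Set.toFinite _)
  rintro A ⟨hA, hAq⟩
  refine ⟨A ^ p ^ (e - 1), isTriangular_pow hA _, ?_⟩
  rw [← pow_mul, ← pow_succ, Nat.sub_add_cancel he, ← hF, hAq]

/-- The matrices `1 + x E₂₀ + y E₃₁ + z E₃₀` are squares over the field with two elements. -/
lemma eight_le_ncard_sq (hF : Fintype.card F = 2) :
    8 ≤ Set.ncard {B : Matrix (Fin 4) (Fin 4) F | ∃ A, IsTriangular A ∧ A ^ 2 = B} := by
  have hchar : CharP F 2 := charP_of_card_eq_prime hF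
  let f : F × F × F → Matrix (Fin 4) (Fin 4) F := fun t =>
    !![1, 0, 0, 0; 0, 1, 0, 0; t.1, 0, 1, 0; t.2.2, t.2.1, 0, 1]
  have hf : Function.Injective f := by
    rintro ⟨x, y, z⟩ ⟨x', y', z'⟩ h
    have h1 := congrFun (congrFun h 2) 0
    have h2 := congrFun (congrFun h 3) 1
    have h3 := congrFun (congrFun h 3) 0
    simp [f] at h1 h2 h3
    simp [h1, h2, h3]
  have hcard : Set.ncard (Set.range f) = 8 := by
    rw [← Set.image_univ, Set.ncard_image_of_injective _ hf, Set.ncard_univ]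
    simp [hF]
  rw [← hcard]
  refine Set.ncard_le_ncard ?_ (Set.toFinite _)
  rintro _ ⟨⟨x, y, z⟩, rfl⟩
  have hsq : ∀ a b c d e : F, a * b = x → b * c = y → c * d + e * a = z →
      ∃ A : Matrix (Fin 4) (Fin 4) F, IsTriangular A ∧ A ^ 2 = f (x, y, z) := by
    rintro a b c d e rfl rfl rfl
    refine ⟨!![1, 0, 0, 0; a, 1, 0, 0; d, b, 1, 0; 0, e, c, 1], ⟨?_, ?_⟩, ?_⟩
    · intro i j hij
      fin_cases i <;> fin_cases j <;> simp at hij ⊢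
    · intro i
      fin_cases i <;> simp
    · have h2 : (2 : F) = 0 := CharTwo.two_eq_zero
      rw [pow_two]
      ext i j
      fin_cases i <;> fin_cases j <;>
        simp [f, Matrix.mul_apply, Fin.sum_univ_four, CharTwo.add_self_eq_zero] <;> grind
  by_cases hx : x = 0
  · by_cases hy : y = 0
    · exact hsq 1 0 0 0 z (by simp [hx]) (by simp [hy]) (by simp)
    · exact hsq 0 1 y (y⁻¹ * z) 0 (by simp [hx]) (by simp) (by simp [hy])
  · exact hsq x 1 y 0 (z * x⁻¹) (by simp) (by simp) (by simp [hx])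

lemma powerBound_le_ratio_sq (hF : Fintype.card F = 2) :
    powerBound 2 2 4 ≤
      (Set.ncard {B : Matrix (Fin 4) (Fin 4) F | ∃ A, IsTriangular A ∧ A ^ 2 = B} : ℝ) /
        cardTriangular F 4 := by
  have hT : cardTriangular F 4 ≤ 64 := by
    have h0 := cardTriangular_succ_le F 0
    have h1 := cardTriangular_succ_le F 1
    have h2 := cardTriangular_succ_le F 2
    have h3 := cardTriangular_succ_le F 3
    rw [cardTriangular_zero] at h0
    norm_num [hF] at h0 h1 h2 h3
    omega
  have hT' : (cardTriangular F 4 : ℝ) ≤ 64 := by exact_mod_cast hT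
  have hT0 : (0 : ℝ) < cardTriangular F 4 := Nat.cast_pos.mpr (cardTriangular_pos F 4)
  have h8 : (8 : ℝ) ≤
      Set.ncard {B : Matrix (Fin 4) (Fin 4) F | ∃ A, IsTriangular A ∧ A ^ 2 = B} := by
    exact_mod_cast eight_le_ncard_sq F hF
  rw [le_div_iff₀ hT0]
  norm_num [powerBound]
  linarith

end Powers

end TriangularPower

open TriangularPower

theorem pPowerPaper.stmt16 (p e q n : ℕ) (hp : p.Prime) (he : 0 < e) (hq : q = p ^ e)
    (hqn : (n : ℤ) - p - 1 < q)
    (F : Type*) [Field F] [Fintype F] (hF : Fintype.card F = q) :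
    (Set.ncard {B : Matrix (Fin n) (Fin n) F | ∃ A, IsTriangular A ∧ A ^ p = B} : ℝ) /
        Set.ncard {A : Matrix (Fin n) (Fin n) F | IsTriangular A}
      ≥ 2 ^ (n - 2) / (9 * ((q : ℝ) - 1) ^ (n - 2) * (q : ℝ) ^ ((p - 1) * (n - p))) := by
  change powerBound p q n ≤ (_ : ℝ) / cardTriangular F n
  have hpq : p = q ∨ 2 * p ≤ q := by
    rcases Nat.lt_or_ge e 2 with h | h
    · left
      obtain rfl : e = 1 := by omega
      simpa using hq.symm
    · right
      calc 2 * p ≤ p * p := Nat.mul_le_mul_right p hp.two_le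
        _ = p ^ 2 := (pow_two p).symm
        _ ≤ p ^ e := Nat.pow_le_pow_right hp.pos h
        _ = q := hq.symm
  by_cases hexc : q = 2 ∧ n = 4
  · obtain ⟨rfl, rfl⟩ := hexc
    obtain rfl : p = 2 := by
      have := hp.two_le
      omega
    exact powerBound_le_ratio_sq F hF
  · have hbound := powerBound_le (X := semisimpleRatio F) (q := q) (n := n)
      (semisimpleRatio_nonneg F) (semisimpleRatio_zero F)
      (fun k j => hF ▸ semisimpleRatio_succ_ge F k j) hp hpq (by omega) hexc
    refine hbound.trans ?_
    exact div_le_div_of_nonneg_right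
      (Nat.cast_le.mpr (cardSemisimple_le_ncard_pow F he (hF.trans hq))) (Nat.cast_nonneg _)
end

section
/- Let p be a prime, q a power of p, and n a positive integer. Write T = T(n,q), U = U(n,q), D = D(n,q). Then T^p = ⋃_{d ∈ D, v ∈ C_U(d)^p} { y^{−1} (dv) y : y ∈ U }; that is, an element x ∈ T is a p-th power in T if and only if x = y^{−1} d v y for some y ∈ U, d ∈ D and v ∈ C_U(d)^p. -/
namespace Matrix

variable {n : ℕ} {F : Type*} [Field F] {A B : Matrix (Fin n) (Fin n) F}

theorem IsLowerTriangular.mul_apply_self (hA : A.IsLowerTriangular) (hB : B.IsLowerTriangular)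
    (i : Fin n) : (A * B) i i = A i i * B i i := by
  rw [mul_apply, Finset.sum_eq_single i]
  · intro j _ hj
    rcases lt_or_gt_of_ne hj with h | h
    · rw [hB (i := j) (j := i) h, mul_zero]
    · rw [hA (i := i) (j := j) h, zero_mul]
  · simp

theorem IsLowerTriangular.pow_apply_self (hA : A.IsLowerTriangular) (k : ℕ) (i : Fin n) :
    (A ^ k) i i = A i i ^ k := by
  induction k with
  | zero => simp
  | succ k ih => rw [pow_succ, mul_apply_self (BlockTriangular.pow hA k) hA, ih, pow_succ]

theorem IsLowerTriangular.pow_eq_zero_of_diag_eq_zero (hA : A.IsLowerTriangular)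
    (h : ∀ i, A i i = 0) : A ^ n = 0 := by
  have hchar : A.charpoly = Polynomial.X ^ n := by
    have hAt : Aᵀ.IsUpperTriangular := fun i j hij => hA hij
    rw [← charpoly_transpose]
    refine (charpoly_of_isUpperTriangular _ hAt).trans ?_
    simp [h]
  simpa [hchar] using A.aeval_self_charpoly

theorem isLowerTriangular_diagonal (d : Fin n → F) : (diagonal d).IsLowerTriangular :=
  blockTriangular_diagonal d

end Matrix

open Matrix

namespace IsUnitriangular

variable {n : ℕ} {F : Type*} [Field F] {A B : Matrix (Fin n) (Fin n) F}

theorem isLowerTriangular (hA : IsUnitriangular A) : A.IsLowerTriangular :=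
  fun i j h => hA.2 i j h

theorem det_eq_one (hA : IsUnitriangular A) : A.det = 1 := by
  rw [det_of_isLowerTriangular _ hA.isLowerTriangular]
  simp [hA.1]

theorem isUnit_det (hA : IsUnitriangular A) : IsUnit A.det := by
  simp [hA.det_eq_one]

theorem inv (hA : IsUnitriangular A) : IsUnitriangular A⁻¹ := by
  let _ := A.invertibleOfIsUnitDet hA.isUnit_det
  have hinv : A⁻¹.IsLowerTriangular :=
    blockTriangular_inv_of_blockTriangular hA.isLowerTriangular
  refine ⟨fun i => ?_, fun i j h => hinv h⟩
  have h := hA.isLowerTriangular.mul_apply_self hinv i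
  rw [A.mul_nonsing_inv hA.isUnit_det, hA.1 i, one_mul, one_apply_eq] at h
  exact h.symm

end IsUnitriangular

section FiniteField

variable {n : ℕ} {F : Type*} [Field F] [Fintype F]

/-- An element `s` of a ring with `s ^ m = 1` is intertwined with any `D` with `D ^ m = 1` by
the twisted average of the powers of `s`. -/
theorem mul_sum_pow_mul_pow_eq {R : Type*} [Ring R] {D s : R} {m : ℕ} (hD : D ^ m = 1)
    (hs : s ^ m = 1) :
    D * ∑ i ∈ Finset.range m, D ^ (m - i) * s ^ i =
      (∑ i ∈ Finset.range m, D ^ (m - i) * s ^ i) * s := by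
  have h := Finset.sum_range_sub' (fun i => D ^ (m + 1 - i) * s ^ i) m
  rw [Finset.sum_sub_distrib] at h
  have hright : D ^ (m + 1 - 0) * s ^ 0 - D ^ (m + 1 - m) * s ^ m = 0 := by
    simp [hs, pow_succ, hD]
  rw [hright, sub_eq_zero] at h
  rw [Finset.mul_sum, Finset.sum_mul]
  convert h using 1
  · refine Finset.sum_congr rfl fun i hi => ?_
    have hi := Finset.mem_range.mp hi
    rw [← mul_assoc, ← pow_succ', show m - i + 1 = m + 1 - i by omega]
  · refine Finset.sum_congr rfl fun i _ => ?_
    rw [mul_assoc, ← pow_succ, Nat.add_sub_add_right]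

/-- A lower triangular matrix over a field with `q` elements which is killed by
`X ^ (q - 1) - 1` is conjugate to its diagonal by a unitriangular matrix. -/
theorem exists_isUnitriangular_mul_eq_diagonal_mul {s : Matrix (Fin n) (Fin n) F}
    (hs : s.IsLowerTriangular) (hd : ∀ i, s i i ≠ 0) (hpow : s ^ (Fintype.card F - 1) = 1) :
    ∃ y, IsUnitriangular y ∧ diagonal (fun i => s i i) * y = y * s := by
  set m := Fintype.card F - 1 with hm
  set D := diagonal (fun i => s i i) with hD
  have hDpow : D ^ m = 1 := by
    rw [hD, diagonal_pow, ← diagonal_one]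
    congr 1
    ext i
    exact FiniteField.pow_card_sub_one_eq_one _ (hd i)
  have hDtri : D.IsLowerTriangular := isLowerTriangular_diagonal _
  have hcast : (m : F) = -1 := by
    rw [hm, Nat.cast_sub Fintype.card_pos, FiniteField.cast_card_eq_zero]
    simp
  refine ⟨-∑ i ∈ Finset.range m, D ^ (m - i) * s ^ i, ⟨fun i => ?_, fun i j hij => ?_⟩, ?_⟩
  · rw [Matrix.neg_apply, Matrix.sum_apply, Finset.sum_congr rfl (g := fun _ => (1 : F)), Finset.sum_const,
      Finset.card_range, nsmul_one, hcast, neg_neg]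
    intro k hk
    have hk := Finset.mem_range.mp hk
    rw [IsLowerTriangular.mul_apply_self (BlockTriangular.pow hDtri _) (BlockTriangular.pow hs _),
      hDtri.pow_apply_self, hs.pow_apply_self, hD, diagonal_apply_eq, ← pow_add,
      Nat.sub_add_cancel hk.le]
    exact FiniteField.pow_card_sub_one_eq_one _ (hd i)
  · rw [Matrix.neg_apply, Matrix.sum_apply, Finset.sum_eq_zero, neg_zero]
    intro k _
    exact ((BlockTriangular.pow hDtri _).mul (BlockTriangular.pow hs _)) hij
  · rw [mul_neg, neg_mul, mul_sum_pow_mul_pow_eq hDpow hpow]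

/-- The `q ^ n`-th power of an invertible lower triangular `n × n` matrix over a field with `q`
elements is semisimple: it is killed by the separable polynomial `X ^ (q - 1) - 1`. -/
theorem IsTriangular.pow_card_pow_pow_card_sub_one (hn : 0 < n) {A : Matrix (Fin n) (Fin n) F}
    (hA : IsTriangular A) : (A ^ Fintype.card F ^ n) ^ (Fintype.card F - 1) = 1 := by
  have : Nonempty (Fin n) := ⟨⟨0, hn⟩⟩
  obtain ⟨p, hchar⟩ := CharP.exists F
  obtain ⟨e, hp, hcard⟩ := FiniteField.card F p
  have := Fact.mk hp
  have htri : A.IsLowerTriangular := fun i j h => hA.1 i j h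
  have hpowtri : (A ^ (Fintype.card F - 1)).IsLowerTriangular := BlockTriangular.pow htri _
  have hnil : (A ^ (Fintype.card F - 1) - 1) ^ n = 0 := by
    refine IsLowerTriangular.pow_eq_zero_of_diag_eq_zero
      (BlockTriangular.sub hpowtri blockTriangular_one) fun i => ?_
    rw [Matrix.sub_apply, htri.pow_apply_self, FiniteField.pow_card_sub_one_eq_one _ (hA.2 i),
      one_apply_eq, sub_self]
  have hle : n ≤ p ^ ((e : ℕ) * n) := by
    rw [pow_mul, ← hcard]
    exact (Nat.lt_pow_self Fintype.one_lt_card).le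
  have hcardpow : Fintype.card F ^ n = p ^ ((e : ℕ) * n) := by rw [hcard, pow_mul]
  rw [← pow_mul, mul_comm, pow_mul, ← sub_eq_zero, hcardpow,
    ← one_pow (M := Matrix (Fin n) (Fin n) F) (p ^ ((e : ℕ) * n)),
    ← sub_pow_char_pow_of_commute _ _ (Commute.one_right _)]
  exact pow_eq_zero_of_le hle hnil

/-- Jordan decomposition in the group of invertible lower triangular matrices. -/
theorem IsTriangular.exists_eq_inv_mul_diagonal_mul (hn : 0 < n) {A : Matrix (Fin n) (Fin n) F}
    (hA : IsTriangular A) :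
    ∃ y u, IsUnitriangular y ∧ IsUnitriangular u ∧
      u * diagonal (fun i => A i i) = diagonal (fun i => A i i) * u ∧
      A = y⁻¹ * (diagonal (fun i => A i i) * u) * y := by
  have htri : A.IsLowerTriangular := fun i j h => hA.1 i j h
  set s := A ^ Fintype.card F ^ n with hs
  have hstri : s.IsLowerTriangular := BlockTriangular.pow htri _
  have hsdiag : ∀ i, s i i = A i i := fun i => by
    rw [hs, htri.pow_apply_self, FiniteField.pow_card_pow]
  obtain ⟨y, hy, hys⟩ := exists_isUnitriangular_mul_eq_diagonal_mul hstri
    (fun i => hsdiag i ▸ hA.2 i) (hA.pow_card_pow_pow_card_sub_one hn)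
  simp only [hsdiag] at hys
  set D := diagonal (fun i => A i i) with hD
  set E := diagonal (fun i => (A i i)⁻¹) with hE
  have hDE : D * E = 1 := by
    simp [hD, hE, hA.2]
  have hED : E * D = 1 := by
    simp [hD, hE, hA.2]
  have hyinv : y⁻¹ * y = 1 := y.nonsing_inv_mul hy.isUnit_det
  have hinvy : y * y⁻¹ = 1 := y.mul_nonsing_inv hy.isUnit_det
  have hDs : D = y * s * y⁻¹ := by
    rw [← hys, mul_assoc, hinvy, mul_one]
  have hcomm : Commute (y * A * y⁻¹) D := by
    have hAs : A * s = s * A := (Commute.pow_right (Commute.refl A) _).eq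
    rw [hDs]
    calc y * A * y⁻¹ * (y * s * y⁻¹) = y * A * (y⁻¹ * y) * s * y⁻¹ := by simp only [mul_assoc]
      _ = y * s * (y⁻¹ * y) * A * y⁻¹ := by
        rw [hyinv, mul_one, mul_one, mul_assoc y, hAs, ← mul_assoc]
      _ = y * s * y⁻¹ * (y * A * y⁻¹) := by simp only [mul_assoc]
  have hEtri : E.IsLowerTriangular := isLowerTriangular_diagonal _
  have hyA : (y * A).IsLowerTriangular := hy.isLowerTriangular.mul htri
  have hB : (y * A * y⁻¹).IsLowerTriangular := hyA.mul hy.inv.isLowerTriangular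
  refine ⟨y, E * (y * A * y⁻¹), hy, ⟨fun i => ?_, fun i j hij => (hEtri.mul hB) hij⟩, ?_, ?_⟩
  · rw [hEtri.mul_apply_self hB, hyA.mul_apply_self hy.inv.isLowerTriangular,
      hy.isLowerTriangular.mul_apply_self htri, hy.1, hy.inv.1, one_mul, mul_one, hE,
      diagonal_apply_eq, inv_mul_cancel₀ (hA.2 i)]
  · rw [mul_assoc, hcomm.eq, ← mul_assoc E, ← mul_assoc D, hED, hDE]
  · rw [← mul_assoc D, hDE, one_mul]
    calc A = (y⁻¹ * y) * A * (y⁻¹ * y) := by rw [hyinv, one_mul, mul_one]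
      _ = y⁻¹ * (y * A * y⁻¹) * y := by simp only [mul_assoc]

end FiniteField

theorem Matrix.inv_mul_mul_pow {n : ℕ} {F : Type*} [Field F] {y : Matrix (Fin n) (Fin n) F}
    (hy : IsUnit y.det) (B : Matrix (Fin n) (Fin n) F) (k : ℕ) :
    (y⁻¹ * B * y) ^ k = y⁻¹ * B ^ k * y := by
  induction k with
  | zero => simp [y.nonsing_inv_mul hy]
  | succ k ih =>
    calc (y⁻¹ * B * y) ^ (k + 1) = y⁻¹ * B ^ k * (y * y⁻¹) * B * y := by
          rw [pow_succ, ih]; simp only [mul_assoc]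
      _ = y⁻¹ * B ^ (k + 1) * y := by
          rw [y.mul_nonsing_inv hy, mul_one, pow_succ, mul_assoc y⁻¹]

theorem Matrix.commute_diagonal_comp {n : ℕ} {F : Type*} [Field F]
    {u : Matrix (Fin n) (Fin n) F} {d : Fin n → F} (h : u * diagonal d = diagonal d * u)
    (f : F → F) : u * diagonal (f ∘ d) = diagonal (f ∘ d) * u := by
  ext i j
  have hij := congrFun (congrFun h i) j
  rw [mul_diagonal, diagonal_mul, mul_comm] at hij
  rw [mul_diagonal, diagonal_mul, mul_comm]
  by_cases hu : u i j = 0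
  · simp [hu]
  · simp [mul_right_cancel₀ hu hij]

/-- `T(n,q)^p` is the union, over `d ∈ D(n,q)` and `v ∈ C_{U(n,q)}(d)^p`, of the
`U(n,q)`-conjugacy classes of `d v`: an element `x ∈ T(n,q)` is a `p`-th power in
`T(n,q)` if and only if `x = y⁻¹ (d uᵖ) y` for some `y, u ∈ U(n,q)` with `u`
centralizing the invertible diagonal matrix `d`. -/
theorem pPowerPaper.stmt17 (p e q : ℕ) (hp : p.Prime) (he : 0 < e) (hq : q = p ^ e)
    (F : Type*) [Field F] [Fintype F] (hF : Fintype.card F = q)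
    (n : ℕ) (hn : 0 < n) (x : Matrix (Fin n) (Fin n) F) :
    (∃ A, IsTriangular A ∧ A ^ p = x) ↔
      ∃ (y : Matrix (Fin n) (Fin n) F) (d : Fin n → F) (u : Matrix (Fin n) (Fin n) F),
        IsUnitriangular y ∧ (∀ i, d i ≠ 0) ∧ IsUnitriangular u ∧
        u * Matrix.diagonal d = Matrix.diagonal d * u ∧
        x = y⁻¹ * (Matrix.diagonal d * u ^ p) * y := by
  constructor
  · rintro ⟨A, hA, rfl⟩
    obtain ⟨y, u, hy, hu, hcomm, hAeq⟩ := hA.exists_eq_inv_mul_diagonal_mul hn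
    refine ⟨y, fun i => A i i ^ p, u, hy, fun i => pow_ne_zero _ (hA.2 i), hu,
      Matrix.commute_diagonal_comp hcomm (· ^ p), ?_⟩
    conv_lhs => rw [hAeq]
    rw [Matrix.inv_mul_mul_pow hy.isUnit_det, Commute.mul_pow hcomm.symm, diagonal_pow]
    rfl
  · rintro ⟨y, d, u, hy, hd, hu, hcomm, rfl⟩
    set c : Fin n → F := (· ^ p ^ (e - 1)) ∘ d with hc
    have hcpow : diagonal c ^ p = diagonal d := by
      rw [diagonal_pow]
      congr 1
      ext i
      simp only [hc, Pi.pow_apply, Function.comp_apply]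
      rw [← pow_mul, ← pow_succ, Nat.sub_add_cancel he, ← hq, ← hF, FiniteField.pow_card]
    have hctri : (diagonal c).IsLowerTriangular := isLowerTriangular_diagonal c
    have hcu : (diagonal c * u).IsLowerTriangular := hctri.mul hu.isLowerTriangular
    have hycu : (y⁻¹ * (diagonal c * u)).IsLowerTriangular := hy.inv.isLowerTriangular.mul hcu
    refine ⟨y⁻¹ * (diagonal c * u) * y,
      ⟨fun i j hij => (hycu.mul hy.isLowerTriangular) hij, fun i => ?_⟩, ?_⟩
    · rw [hycu.mul_apply_self hy.isLowerTriangular, hy.inv.isLowerTriangular.mul_apply_self hcu,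
        hctri.mul_apply_self hu.isLowerTriangular, hy.1, hy.inv.1, hu.1, one_mul, mul_one,
        mul_one, diagonal_apply_eq]
      exact pow_ne_zero _ (hd i)
    · rw [Matrix.inv_mul_mul_pow hy.isUnit_det,
        Commute.mul_pow (Matrix.commute_diagonal_comp hcomm _).symm, hcpow]
end
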